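/- arXiv:2403.07484 — 2 statements merged into one kernel-verified Lean document; each statement's English description precedes it below -/
import Mathlib

section
/- Let F be a free filter on ω. Then F has the Nikodym property if and only if there is no sequence (μ_n) of finitely supported nonnegative measures on N_F such that (1) supp(μ_n) ⊆ ℕ for every n, (2) μ_n(ℕ) → ∞ as n → ∞, and (3) μ_n(ℕ ∖ A) → 0 as n → ∞ for every A ∈ F. -/
open Filter Topology Set MeasureTheory
open scoped ENNReal NNReal

noncomputable section

/-- The space `N_F = ℕ ∪ {p_F}`, modelled as `Option ℕ` with `none` playing the role of `p_F`:
every natural number (i.e. `some n`) is isolated, and a set containing `none` is open iff its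
trace on `ℕ` belongs to `F`. -/
def NFTop (F : Filter ℕ) : TopologicalSpace (Option ℕ) where
  IsOpen U := none ∈ U → {n : ℕ | some n ∈ U} ∈ F
  isOpen_univ := fun _ => Filter.univ_mem
  isOpen_inter := fun U V hU hV h => Filter.inter_mem (hU h.1) (hV h.2)
  isOpen_sUnion := fun S hS h => by
    obtain ⟨U, hUS, hU⟩ := h
    exact Filter.mem_of_superset (hS U hUS hU) fun n hn => ⟨U, hUS, hn⟩

/-- A finitely supported signed measure on `N_F` is modelled as a finitely supported
function `Option ℕ →₀ ℝ`; its value on a set `A` is the sum of its weights on `A`. -/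
def fsMeas (μ : Option ℕ →₀ ℝ) (A : Set (Option ℕ)) : ℝ :=
  ∑ x ∈ μ.support, A.indicator (fun y => μ y) x

/-- The norm `‖μ‖ = Σ |α_i|` of a finitely supported signed measure. -/
def fsNorm (μ : Option ℕ →₀ ℝ) : ℝ :=
  ∑ x ∈ μ.support, |μ x|

/-- `‖μ ↾ B‖`, the variation of `μ` on a set `B`. -/
def fsRestrNorm (μ : Option ℕ →₀ ℝ) (B : Set (Option ℕ)) : ℝ :=
  ∑ x ∈ μ.support, B.indicator (fun y => |μ y|) x

/-- The integral `∫ f dμ` of a function against a finitely supported signed measure. -/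
def fsInteg (μ : Option ℕ →₀ ℝ) (f : Option ℕ → ℝ) : ℝ :=
  ∑ x ∈ μ.support, μ x * f x

/-- An anti-Nikodym sequence on `N_F`: `‖μ_n‖ → ∞` and `μ_n(A) → 0` for every clopen `A`. -/
def IsANSeq (F : Filter ℕ) (μ : ℕ → (Option ℕ →₀ ℝ)) : Prop :=
  Tendsto (fun n => fsNorm (μ n)) atTop atTop ∧
    ∀ A : Set (Option ℕ), @IsClopen _ (NFTop F) A →
      Tendsto (fun n => fsMeas (μ n) A) atTop (nhds 0)

/-- A free filter `F` has the Nikodym property if there is no anti-Nikodym sequence on `N_F`. -/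
def HasNikodymProp (F : Filter ℕ) : Prop :=
  ¬ ∃ μ : ℕ → (Option ℕ →₀ ℝ), IsANSeq F μ

/-- A finitely supported (nonnegative) measure on `ℕ`, evaluated on a set `A ⊆ ℕ`. -/
def natMeas (μ : ℕ →₀ ℝ) (A : Set ℕ) : ℝ :=
  ∑ x ∈ μ.support, A.indicator (fun y => μ y) x

/-- The norm of a finitely supported measure on `ℕ`. -/
def natNorm (μ : ℕ →₀ ℝ) : ℝ :=
  ∑ x ∈ μ.support, |μ x|

/-- `at⁺(μ)`: the largest atom of a finitely supported measure on `ℕ`. -/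
def atPlus (μ : ℕ →₀ ℝ) : ℝ := sSup ((fun x => μ x) '' ↑μ.support)

/-- `at⁻(μ)`: the smallest atom of a finitely supported measure on `ℕ`. -/
def atMinus (μ : ℕ →₀ ℝ) : ℝ := sInf ((fun x => μ x) '' ↑μ.support)

/-- A submeasure on `ω`. -/
structure Submeasure where
  toFun : Set ℕ → ℝ≥0∞
  empty' : toFun ∅ = 0
  finite_singleton' : ∀ n : ℕ, toFun {n} ≠ ⊤
  mono' : ∀ ⦃A B : Set ℕ⦄, A ⊆ B → toFun A ≤ toFun B
  subadd' : ∀ A B : Set ℕ, toFun (A ∪ B) ≤ toFun A + toFun B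

/-- Lower semicontinuity of a submeasure: `φ(A) = lim_n φ(A ∩ [0,n])`. -/
def Submeasure.LSC (φ : Submeasure) : Prop :=
  ∀ A : Set ℕ, Tendsto (fun n : ℕ => φ.toFun (A ∩ Set.Iic n)) atTop (nhds (φ.toFun A))

/-- The exhaustive ideal `Exh(φ) = {A : lim_n φ(A ∖ [0,n]) = 0}` of a submeasure. -/
def Exh (φ : Submeasure) : Set (Set ℕ) :=
  {A : Set ℕ | Tendsto (fun n : ℕ => φ.toFun (A \ Set.Iic n)) atTop (nhds 0)}

/-- A density submeasure: `φ = sup_n μ_n` for a sequence of finitely supported nonnegative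
measures on `ℕ` with pairwise disjoint supports. -/
def Submeasure.IsDensity (φ : Submeasure) : Prop :=
  ∃ μ : ℕ → (ℕ →₀ ℝ), (∀ n x, 0 ≤ μ n x) ∧
    (∀ m n, m ≠ n → Disjoint (μ m).support (μ n).support) ∧
    ∀ A : Set ℕ, φ.toFun A = ⨆ n : ℕ, ENNReal.ofReal (natMeas (μ n) A)

/-- A non-pathological submeasure: `φ(A)` is the supremum of `μ(A)` over all nonnegative
(σ-additive) measures `μ` on `ℕ` dominated by `φ`. -/
def Submeasure.Nonpathological (φ : Submeasure) : Prop :=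
  ∀ A : Set ℕ,
    φ.toFun A =
      ⨆ (w : ℕ → ℝ≥0∞) (_ : ∀ B : Set ℕ, ∑' n : B, w n ≤ φ.toFun B), ∑' n : A, w n

/-- An ideal on `ω`: contains all finite sets, closed under subsets and finite unions,
and does not contain `ℕ` itself. -/
def IsIdeal (I : Set (Set ℕ)) : Prop :=
  (∀ A : Set ℕ, A.Finite → A ∈ I) ∧
    (∀ A B : Set ℕ, A ⊆ B → B ∈ I → A ∈ I) ∧
    (∀ A B : Set ℕ, A ∈ I → B ∈ I → A ∪ B ∈ I) ∧
    Set.univ ∉ I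

/-- The Katětov order on families of subsets of `ℕ`. -/
def KatLE (I J : Set (Set ℕ)) : Prop :=
  ∃ f : ℕ → ℕ, ∀ A ∈ I, f ⁻¹' A ∈ J

/-- The dual filter `I*` of an ideal `I` (as a `Filter`; when `I` is an ideal, this filter's
sets are exactly the complements of members of `I`). -/
def dualFilter (I : Set (Set ℕ)) : Filter ℕ :=
  Filter.generate {A : Set ℕ | Aᶜ ∈ I}

/-- The class `AN` of all ideals on `ω` whose dual filters do not have the Nikodym property. -/
def ANclass : Set (Set (Set ℕ)) :=
  {I | IsIdeal I ∧ ¬ HasNikodymProp (dualFilter I)}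

/-- A density ideal: `Exh(sup_n μ_n)` for a disjointly supported sequence of finitely
supported nonnegative measures on `ℕ`. -/
def IsDensityIdeal (I : Set (Set ℕ)) : Prop :=
  ∃ μ : ℕ → (ℕ →₀ ℝ), (∀ n x, 0 ≤ μ n x) ∧
    (∀ m n, m ≠ n → Disjoint (μ m).support (μ n).support) ∧
    I = {A : Set ℕ |
      Tendsto (fun m : ℕ => ⨆ n : ℕ, ENNReal.ofReal (natMeas (μ n) (A \ Set.Iic m)))
        atTop (nhds 0)}

/-- The asymptotic density submeasure `φ_d(A) = sup_n |A ∩ [2^n, 2^{n+1})|/2^n`. -/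
def phid (A : Set ℕ) : ℝ≥0∞ :=
  ⨆ n : ℕ, ((A ∩ Set.Ico (2 ^ n) (2 ^ (n + 1))).ncard : ℝ≥0∞) / 2 ^ n

/-- The asymptotic density zero ideal `Z = Exh(φ_d)`. -/
def Zideal : Set (Set ℕ) :=
  {A : Set ℕ | Tendsto (fun m : ℕ => phid (A \ Set.Iic m)) atTop (nhds 0)}

/-- `Exh(sup_{n ≥ 1} ν_n)` for a sequence of finitely supported measures indexed by `n ≥ 1`. -/
def ExhSupPos (ν : ℕ → (ℕ →₀ ℝ)) : Set (Set ℕ) :=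
  {A : Set ℕ |
    Tendsto (fun m : ℕ => ⨆ n : ℕ, ENNReal.ofReal (natMeas (ν (n + 1)) (A \ Set.Iic m)))
      atTop (nhds 0)}

/-- `PhiStart f n` is the left endpoint of the interval `I_n` in the interval partition
associated with `f` (so `I_n = [PhiStart f n, PhiStart f (n+1))` has `n·f(n)` elements). -/
def PhiStart (f : ℕ → ℕ) (n : ℕ) : ℕ :=
  ∑ k ∈ Finset.range n, k * f k

/-- The density ideal `Φ(f) = Exh(sup_{n≥1} μ_n^f)`, where `μ_n^f` gives mass `1/f(n)` to each
point of the interval `I_n` (of size `n·f(n)`), so that `‖μ_n^f‖ = n`. -/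
def PhiIdeal (f : ℕ → ℕ) : Set (Set ℕ) :=
  {A : Set ℕ |
    Tendsto (fun m : ℕ => ⨆ n : ℕ,
        ENNReal.ofReal
          (((A \ Set.Iic m) ∩ Set.Ico (PhiStart f (n + 1)) (PhiStart f (n + 2))).ncard
            / f (n + 1)))
      atTop (nhds 0)}

/-- The dominating number `𝔡`. -/
def domNumber : Cardinal :=
  sInf {c : Cardinal | ∃ D : Set (ℕ → ℕ), Cardinal.mk D = c ∧
    ∀ g : ℕ → ℕ, ∃ f ∈ D, ∀ᶠ n in atTop, g n ≤ f n}

/-- The unbounding number `𝔟`. -/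
def unbNumber : Cardinal :=
  sInf {c : Cardinal | ∃ U : Set (ℕ → ℕ), Cardinal.mk U = c ∧
    ∀ g : ℕ → ℕ, ∃ f ∈ U, {n : ℕ | g n < f n}.Infinite}

/-- A P-ideal: every countable family in `J` has a pseudo-union in `J`. -/
def IsPIdeal (J : Set (Set ℕ)) : Prop :=
  ∀ A : ℕ → Set ℕ, (∀ n, A n ∈ J) → ∃ B ∈ J, ∀ n, (A n \ B).Finite

/-- The characteristic-function embedding of `P(ℕ)` into the Cantor space `2^ℕ`. -/
def chi (A : Set ℕ) : ℕ → Bool :=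
  fun n => @decide (n ∈ A) (Classical.propDecidable _)

end

lemma fsMeas_eq_sum {μ : Option ℕ →₀ ℝ} {S : Finset (Option ℕ)} (hS : μ.support ⊆ S)
    (A : Set (Option ℕ)) : fsMeas μ A = ∑ x ∈ S, A.indicator (fun y => μ y) x := by
  refine Finset.sum_subset hS fun x _ hx => ?_
  rw [Finsupp.notMem_support_iff] at hx
  by_cases h : x ∈ A <;> simp [h, hx]

lemma fsMeas_finset (μ : Option ℕ →₀ ℝ) (C : Finset (Option ℕ)) :
    fsMeas μ C = ∑ x ∈ C, μ x := by
  classical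
  rw [fsMeas_eq_sum Finset.subset_union_left (C : Set (Option ℕ)) (S := μ.support ∪ C)]
  rw [← Finset.sum_subset (Finset.subset_union_right (s₁ := μ.support))]
  · exact Finset.sum_congr rfl fun x hx => by simp [hx]
  · intro x _ hx
    simp [hx]

lemma fsMeas_add_of_disjoint (μ : Option ℕ →₀ ℝ) {A B : Set (Option ℕ)} (h : Disjoint A B) :
    fsMeas μ (A ∪ B) = fsMeas μ A + fsMeas μ B := by
  simp only [fsMeas, Set.indicator_union_of_disjoint h, Finset.sum_add_distrib]

/-- A finite set carries a subset on which the signed sum captures half of the absolute sum. -/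
lemma exists_subset_half_sum_abs_le {α : Type*} (f : α → ℝ) (D : Finset α) :
    ∃ C ⊆ D, (∑ x ∈ D, |f x|) / 2 ≤ |∑ x ∈ C, f x| := by
  classical
  have h1 : ∑ x ∈ D, |f x| =
      ∑ x ∈ D with 0 ≤ f x, f x - ∑ x ∈ D with ¬ 0 ≤ f x, f x := by
    rw [← Finset.sum_filter_add_sum_filter_not D (fun x => 0 ≤ f x), sub_eq_add_neg,
      ← Finset.sum_neg_distrib]
    congr 1
    · exact Finset.sum_congr rfl fun x hx => abs_of_nonneg (Finset.mem_filter.1 hx).2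
    · exact Finset.sum_congr rfl fun x hx =>
        abs_of_neg (not_le.1 (Finset.mem_filter.1 hx).2)
  by_contra! h
  have hp := (abs_lt.1 (h _ (Finset.filter_subset (fun x => 0 ≤ f x) D))).2
  have hn := (abs_lt.1 (h _ (Finset.filter_subset (fun x => ¬ 0 ≤ f x) D))).1
  linarith

/-- A Schur-type property: finitely supported signed measures converging to zero on every set
converge to zero in norm. -/
lemma tendsto_fsNorm_zero {μ : ℕ → (Option ℕ →₀ ℝ)}
    (h : ∀ C : Set (Option ℕ), Tendsto (fun n => fsMeas (μ n) C) atTop (𝓝 0)) :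
    Tendsto (fun n => fsNorm (μ n)) atTop (𝓝 0) := by
  classical
  by_contra hcon
  obtain ⟨ε, hε, hfreq⟩ : ∃ ε > 0, ∀ N, ∃ n ≥ N, ε ≤ fsNorm (μ n) := by
    rw [Metric.tendsto_atTop] at hcon
    push Not at hcon
    obtain ⟨ε, hε, H⟩ := hcon
    refine ⟨ε, hε, fun N => ?_⟩
    obtain ⟨n, hn, hd⟩ := H N
    rw [Real.dist_eq, sub_zero,
      abs_of_nonneg (Finset.sum_nonneg fun _ _ => abs_nonneg _)] at hd
    exact ⟨n, hn, hd⟩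
  have hfin : ∀ T : Finset (Option ℕ),
      Tendsto (fun n => ∑ x ∈ T, |μ n x|) atTop (𝓝 0) := fun T => by
    rw [← Finset.sum_const_zero (s := T)]
    refine tendsto_finsetSum _ fun x _ => ?_
    have := (h ({x} : Finset (Option ℕ))).abs
    simpa only [fsMeas_finset, Finset.sum_singleton, abs_zero] using this
  obtain ⟨f, hP, hr⟩ := exists_seq_of_forall_finset_exists
    (α := ℕ × Finset (Option ℕ) × Finset (Option ℕ))
    (fun a => (μ a.1).support ⊆ a.2.1 ∧ a.2.2 ⊆ a.2.1 ∧
      3 * ε / 8 ≤ |∑ x ∈ a.2.2, μ a.1 x|)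
    (fun a b => a.1 < b.1 ∧ a.2.1 ⊆ b.2.1 ∧ Disjoint b.2.2 a.2.1 ∧
      ∑ x ∈ a.2.1, |μ b.1 x| ≤ ε / 8) (by
    intro s _
    set T := s.biUnion fun a => a.2.1 with hT
    have hTs : ∀ a ∈ s, a.2.1 ⊆ T := fun a ha => Finset.subset_biUnion_of_mem (fun a => a.2.1) ha
    obtain ⟨N, hN⟩ := eventually_atTop.1
      ((hfin T).eventually (ge_mem_nhds (show (0 : ℝ) < ε / 8 by positivity)))
    obtain ⟨n, hn, hnε⟩ := hfreq (max N (s.sup (fun a => a.1) + 1))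
    have hTn := hN n (le_trans (le_max_left _ _) hn)
    obtain ⟨C, hCD, hC⟩ := exists_subset_half_sum_abs_le (μ n) ((μ n).support \ T)
    have hsum : fsNorm (μ n) ≤ ∑ x ∈ (μ n).support \ T, |μ n x| + ∑ x ∈ T, |μ n x| := by
      rw [← Finset.sum_union Finset.sdiff_disjoint]
      refine Finset.sum_le_sum_of_subset_of_nonneg ?_ fun _ _ _ => abs_nonneg _
      intro x hx
      simp [hx]
    refine ⟨(n, (μ n).support ∪ T, C), ⟨Finset.subset_union_left, ?_, ?_⟩, ?_⟩
    · exact (hCD.trans Finset.sdiff_subset).trans Finset.subset_union_left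
    · dsimp only
      linarith
    · intro a ha
      refine ⟨?_, (hTs a ha).trans Finset.subset_union_right, ?_, ?_⟩
      · have : a.1 ≤ s.sup (fun a => a.1) := Finset.le_sup (f := fun a => a.1) ha
        have := le_trans (le_max_right _ _) hn
        dsimp only
        omega
      · exact Finset.disjoint_of_subset_left hCD
          (Finset.disjoint_of_subset_right (hTs a ha) Finset.sdiff_disjoint)
      · exact (Finset.sum_le_sum_of_subset_of_nonneg (hTs a ha)
          fun _ _ _ => abs_nonneg _).trans hTn)
  have hmono : StrictMono fun k => (f k).1 := fun i j hij => (hr i j hij).1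
  have hlim := ((h (⋃ k, ((f k).2.2 : Set (Option ℕ)))).comp hmono.tendsto_atTop).abs
  rw [abs_zero] at hlim
  obtain ⟨K, hK⟩ := eventually_atTop.1
    (hlim.eventually (gt_mem_nhds (show (0 : ℝ) < ε / 8 by positivity)))
  have hlt := hK (K + 1) (Nat.le_succ K)
  simp only [Function.comp_apply] at hlt
  obtain ⟨hsupp, -, hbig⟩ := hP (K + 1)
  have hsplit : (⋃ k, ((f k).2.2 : Set (Option ℕ))) = ((f (K + 1)).2.2 : Set (Option ℕ)) ∪
      ((⋃ k, ((f k).2.2 : Set (Option ℕ))) \ (f (K + 1)).2.2) := by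
    rw [Set.union_sdiff_cancel (Set.subset_iUnion (fun k => ((f k).2.2 : Set (Option ℕ))) (K + 1))]
  rw [hsplit, fsMeas_add_of_disjoint _ Set.disjoint_sdiff_right, fsMeas_finset] at hlt
  set R := (⋃ k, ((f k).2.2 : Set (Option ℕ))) \ (f (K + 1)).2.2 with hR
  have hrest : |fsMeas (μ (f (K + 1)).1) R| ≤ ε / 8 := by
    refine le_trans ?_ (hr K (K + 1) (Nat.lt_succ_self K)).2.2.2
    refine (Finset.abs_sum_le_sum_abs _ _).trans ?_
    have hsub : ∀ x ∈ (μ (f (K + 1)).1).support, x ∈ R → x ∈ (f K).2.1 := by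
      intro x hx hxR
      obtain ⟨hxU, hxn⟩ := hxR
      obtain ⟨j, hj⟩ := Set.mem_iUnion.1 hxU
      rw [Finset.mem_coe] at hj hxn
      rcases lt_trichotomy j (K + 1) with hlt | rfl | hgt
      · have hjT := (hP j).2.1 hj
        rcases (Nat.lt_succ_iff.1 hlt).eq_or_lt with rfl | hjK
        · exact hjT
        · exact (hr j K hjK).2.1 hjT
      · exact absurd hj hxn
      · exact absurd (hsupp hx) (Finset.disjoint_left.1 (hr _ _ hgt).2.2.1 hj)
    rw [← Finset.sum_filter_add_sum_filter_not _ (fun x => x ∈ R)]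
    rw [Finset.sum_eq_zero (s := Finset.filter (fun x => ¬ x ∈ R) _), add_zero]
    · refine (Finset.sum_le_sum_of_subset_of_nonneg (t := (f K).2.1) ?_ ?_).trans
        (Finset.sum_le_sum (g := fun x => |μ (f (K + 1)).1 x|) ?_)
      · intro x hx
        rw [Finset.mem_filter] at hx
        exact hsub x hx.1 hx.2
      · exact fun _ _ _ => abs_nonneg _
      · intro x _
        by_cases hxR : x ∈ R <;> simp [hxR]
    · intro x hx
      simp [(Finset.mem_filter.1 hx).2]
  have := abs_sub_abs_le_abs_sub (∑ x ∈ (f (K + 1)).2.2, μ (f (K + 1)).1 x)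
    (-fsMeas (μ (f (K + 1)).1) R)
  rw [abs_neg, sub_neg_eq_add] at this
  linarith

lemma isClopen_NFTop_iff {F : Filter ℕ} {A : Set (Option ℕ)} :
    @IsClopen _ (NFTop F) A ↔ (none ∈ A → some ⁻¹' A ∈ F) ∧ (none ∉ A → (some ⁻¹' A)ᶜ ∈ F) := by
  let := NFTop F
  rw [IsClopen, ← isOpen_compl_iff, and_comm]
  rfl

lemma fsMeas_filter (μ : Option ℕ →₀ ℝ) (B C : Set (Option ℕ)) [DecidablePred (· ∈ B)] :
    fsMeas (μ.filter (· ∈ B)) C = fsMeas μ (C ∩ B) := by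
  rw [fsMeas_eq_sum (S := μ.support) (fun x hx => by
    simp only [Finsupp.support_filter, Finset.mem_filter] at hx; exact hx.1), fsMeas]
  refine Finset.sum_congr rfl fun x _ => ?_
  by_cases hC : x ∈ C <;> by_cases hB : x ∈ B <;> simp [hC, hB]

lemma fsNorm_filter (μ : Option ℕ →₀ ℝ) (B : Set (Option ℕ)) [DecidablePred (· ∈ B)] :
    fsNorm (μ.filter (· ∈ B)) = fsRestrNorm μ B := by
  simp only [fsNorm, fsRestrNorm, Finsupp.support_filter, Finset.sum_filter]
  refine Finset.sum_congr rfl fun x _ => ?_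
  by_cases hB : x ∈ B <;> simp [hB]

/-- The variation of a signed measure, restricted to `ℕ`. -/
noncomputable def natVariation (μ : Option ℕ →₀ ℝ) : Option ℕ →₀ ℝ :=
  (μ.mapRange abs abs_zero).erase none

lemma natVariation_none (μ : Option ℕ →₀ ℝ) : natVariation μ none = 0 :=
  Finsupp.erase_same

lemma natVariation_some (μ : Option ℕ →₀ ℝ) (n : ℕ) : natVariation μ (some n) = |μ (some n)| := by
  rw [natVariation, Finsupp.erase_ne (by simp), Finsupp.mapRange_apply]

lemma fsMeas_natVariation (μ : Option ℕ →₀ ℝ) {A : Set (Option ℕ)} (hA : none ∉ A) :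
    fsMeas (natVariation μ) A = fsRestrNorm μ A := by
  rw [fsMeas_eq_sum (S := μ.support), fsRestrNorm]
  · refine Finset.sum_congr rfl fun x _ => ?_
    cases x with
    | none => simp [hA]
    | some n => by_cases h : some n ∈ A <;> simp [h, natVariation_some]
  · intro x hx
    cases x with
    | none => simp [natVariation_none] at hx
    | some n => simpa [natVariation_some] using hx

lemma abs_fsMeas_le_fsRestrNorm (μ : Option ℕ →₀ ℝ) (A : Set (Option ℕ)) :
    |fsMeas μ A| ≤ fsRestrNorm μ A := by
  refine (Finset.abs_sum_le_sum_abs _ _).trans (Finset.sum_le_sum fun x _ => ?_)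
  by_cases h : x ∈ A <;> simp [h]

lemma fsMeas_univ (μ : Option ℕ →₀ ℝ) :
    fsMeas μ Set.univ = μ none + fsMeas μ (Set.range some) := by
  have h : (Set.univ : Set (Option ℕ)) = (({none} : Finset (Option ℕ)) : Set (Option ℕ)) ∪
      Set.range some := by
    ext x; cases x <;> simp
  rw [h, fsMeas_add_of_disjoint, fsMeas_finset, Finset.sum_singleton]
  simp

lemma fsNorm_eq (μ : Option ℕ →₀ ℝ) :
    fsNorm μ = |μ none| + fsRestrNorm μ (Set.range some) := by
  have h := fsMeas_univ (μ.mapRange abs abs_zero)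
  have key : ∀ A, fsMeas (μ.mapRange abs abs_zero) A = fsRestrNorm μ A := fun A => by
    rw [fsMeas_eq_sum (S := μ.support) Finsupp.support_mapRange]
    rfl
  rw [key, key, Finsupp.mapRange_apply] at h
  rw [← h]
  simp [fsNorm, fsRestrNorm]

/-- The measure obtained from `μ` by balancing its mass on `ℕ` with an atom at the point `none`. -/
noncomputable def balance (μ : Option ℕ →₀ ℝ) : Option ℕ →₀ ℝ :=
  μ.update none (-fsMeas μ (Set.range some))

lemma fsMeas_update_none (μ : Option ℕ →₀ ℝ) (c : ℝ) {A : Set (Option ℕ)} (hA : none ∉ A) :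
    fsMeas (μ.update none c) A = fsMeas μ A := by
  classical
  have h2 : (μ.update none c).support ⊆ insert none μ.support := by
    rw [Finsupp.support_update]
    split_ifs
    · exact (Finset.erase_subset _ _).trans (Finset.subset_insert _ _)
    · exact subset_rfl
  rw [fsMeas_eq_sum h2, fsMeas_eq_sum (Finset.subset_insert none μ.support)]
  refine Finset.sum_congr rfl fun x _ => ?_
  cases x with
  | none => simp [hA]
  | some n => by_cases h : some n ∈ A <;> simp [h]

lemma isANSeq_balance {F : Filter ℕ} {μ : ℕ → (Option ℕ →₀ ℝ)}
    (hinf : Tendsto (fun n => fsMeas (μ n) (Set.range some)) atTop atTop)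
    (hzero : ∀ A ∈ F, Tendsto (fun n => fsMeas (μ n) (some '' Aᶜ)) atTop (𝓝 0)) :
    IsANSeq F fun n => balance (μ n) := by
  have hsmall : ∀ A : Set (Option ℕ), none ∉ A → (some ⁻¹' A)ᶜ ∈ F →
      Tendsto (fun n => fsMeas (balance (μ n)) A) atTop (𝓝 0) := fun A hA hAF => by
    refine (hzero _ hAF).congr fun n => ?_
    rw [balance, fsMeas_update_none _ _ hA, compl_compl, Set.image_preimage_eq_of_subset]
    intro x hx
    cases x with
    | none => exact absurd hx hA
    | some m => exact ⟨m, rfl⟩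
  have huniv : ∀ n, fsMeas (balance (μ n)) Set.univ = 0 := fun n => by
    rw [fsMeas_univ, balance, fsMeas_update_none _ _ (by simp)]
    simp
  refine ⟨tendsto_atTop_mono (fun n => ?_) hinf, fun A hA => ?_⟩
  · rw [fsNorm_eq]
    have h1 := abs_fsMeas_le_fsRestrNorm (balance (μ n)) (Set.range some)
    have h2 : fsMeas (balance (μ n)) (Set.range some) = fsMeas (μ n) (Set.range some) :=
      fsMeas_update_none _ _ (by simp)
    rw [h2] at h1
    linarith [le_abs_self (fsMeas (μ n) (Set.range some)), abs_nonneg (balance (μ n) none)]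
  · rw [isClopen_NFTop_iff] at hA
    by_cases hn : none ∈ A
    · have hc := (hsmall Aᶜ (by simpa using hn) (by simpa using hA.1 hn)).neg
      rw [neg_zero] at hc
      refine hc.congr fun n => ?_
      have := fsMeas_add_of_disjoint (balance (μ n)) (disjoint_compl_right (a := A))
      rw [Set.union_compl_self, huniv] at this
      linarith
    · exact hsmall A hn (hA.2 hn)

lemma IsANSeq.tendsto_natVariation_atTop {F : Filter ℕ} {μ : ℕ → (Option ℕ →₀ ℝ)}
    (h : IsANSeq F μ) :
    Tendsto (fun n => fsMeas (natVariation (μ n)) (Set.range some)) atTop atTop := by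
  have hu := h.2 Set.univ (by rw [isClopen_NFTop_iff]; simp)
  have h2 : Tendsto (fun n => fsNorm (μ n) + -|fsMeas (μ n) Set.univ|) atTop atTop :=
    h.1.atTop_add hu.abs.neg
  refine tendsto_atTop_mono (fun n => ?_) (h2.atTop_mul_const (show (0 : ℝ) < 1 / 2 by norm_num))
  rw [fsMeas_natVariation _ (by simp), fsNorm_eq, fsMeas_univ]
  have h3 := abs_fsMeas_le_fsRestrNorm (μ n) (Set.range some)
  have h4 := abs_sub_abs_le_abs_sub (μ n none) (-fsMeas (μ n) (Set.range some))
  rw [abs_neg, sub_neg_eq_add] at h4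
  linarith

lemma IsANSeq.tendsto_natVariation_zero {F : Filter ℕ} {μ : ℕ → (Option ℕ →₀ ℝ)}
    (h : IsANSeq F μ) {A : Set ℕ} (hA : A ∈ F) :
    Tendsto (fun n => fsMeas (natVariation (μ n)) (some '' Aᶜ)) atTop (𝓝 0) := by
  classical
  have hs : Tendsto (fun n => fsNorm ((μ n).filter (· ∈ some '' Aᶜ))) atTop (𝓝 0) := by
    refine tendsto_fsNorm_zero fun C => ?_
    simp only [fsMeas_filter]
    refine h.2 _ (isClopen_NFTop_iff.2 ⟨fun hn => by simp at hn, fun _ => ?_⟩)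
    refine mem_of_superset hA fun m hm hmem => ?_
    simp [hm] at hmem
  refine hs.congr fun n => ?_
  rw [fsNorm_filter, fsMeas_natVariation _ (by simp)]

/-- Theorem `thm_positive_measures`. A free filter `F` on `ω` has the Nikodym
property iff there is no sequence `(μ_n)` of finitely supported nonnegative measures on `N_F`
with `supp(μ_n) ⊆ ℕ`, `μ_n(ℕ) → ∞`, and `μ_n(ℕ ∖ A) → 0` for every `A ∈ F`. -/
theorem nikodym_iff_no_positive_AN_sequence (F : Filter ℕ)
    (hfree : F ≤ Filter.cofinite) (hne : F.NeBot) :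
    HasNikodymProp F ↔
      ¬ ∃ μ : ℕ → (Option ℕ →₀ ℝ),
        (∀ n x, 0 ≤ μ n x) ∧
        (∀ n, μ n none = 0) ∧
        Tendsto (fun n => fsMeas (μ n) (Set.range Option.some)) atTop atTop ∧
        (∀ A ∈ F, Tendsto (fun n => fsMeas (μ n) (Option.some '' Aᶜ)) atTop (nhds 0)) := by
  constructor
  · rintro hF ⟨μ, -, -, hinf, hzero⟩
    exact hF ⟨_, isANSeq_balance hinf hzero⟩
  · rintro hpos ⟨μ, hμ⟩
    refine hpos ⟨fun n => natVariation (μ n), fun n x => ?_, fun n => natVariation_none _,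
      hμ.tendsto_natVariation_atTop, fun A hA => hμ.tendsto_natVariation_zero hA⟩
    cases x with
    | none => exact (natVariation_none _).ge
    | some m => exact (abs_nonneg _).trans (natVariation_some _ m).ge
end

section
/- Let I be a density ideal on ω generated by a sequence (μ_n) of finitely supported nonnegative measures on ℕ with pairwise disjoint supports. The following are equivalent: (1) sup_n ‖μ_n‖ < ∞ and at⁺(μ_n) → 0 as n → ∞; (2) there is a countable family S of subsets of ℕ such that for every A ⊆ ℕ with A ∉ I there is S ∈ S with A ∩ S ∉ I and A ∖ S ∉ I (i.e., the Boolean algebra P(ω)/I contains a countable splitting family); (3) I is totally bounded, i.e., every lower semicontinuous submeasure ψ on ω with Exh(ψ) = I satisfies ψ(ℕ) < ∞; (4) I ≡_K Z; (5) the dual filter I* has the Nikodym property. -/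
open Filter Topology Set MeasureTheory
open scoped ENNReal NNReal

section NatMeas

variable {ν : ℕ →₀ ℝ}

theorem natMeas_mono (hν : ∀ x, 0 ≤ ν x) {A B : Set ℕ} (h : ∀ x ∈ ν.support, x ∈ A → x ∈ B) :
    natMeas ν A ≤ natMeas ν B := by
  classical
  refine Finset.sum_le_sum fun x hx => ?_
  by_cases hA : x ∈ A
  · simp [hA, h x hx hA]
  · rw [Set.indicator_of_notMem hA]
    exact Set.indicator_nonneg (fun y _ => hν y) x

theorem natMeas_nonneg (hν : ∀ x, 0 ≤ ν x) (A : Set ℕ) : 0 ≤ natMeas ν A :=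
  Finset.sum_nonneg fun x _ => Set.indicator_nonneg (fun y _ => hν y) x

theorem natMeas_congr {A B : Set ℕ} (h : ∀ x ∈ ν.support, x ∈ A ↔ x ∈ B) :
    natMeas ν A = natMeas ν B := by
  classical
  refine Finset.sum_congr rfl fun x hx => ?_
  simp only [Set.indicator_apply, h x hx]

theorem natMeas_empty : natMeas ν ∅ = 0 := by
  simp [natMeas]

theorem natMeas_inter_add_diff (A S : Set ℕ) :
    natMeas ν (A ∩ S) + natMeas ν (A \ S) = natMeas ν A := by
  classical
  unfold natMeas
  rw [← Finset.sum_add_distrib]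
  refine Finset.sum_congr rfl fun x _ => ?_
  by_cases hA : x ∈ A <;> by_cases hS : x ∈ S <;> simp [hA, hS]

theorem natMeas_union_le (hν : ∀ x, 0 ≤ ν x) (A B : Set ℕ) :
    natMeas ν (A ∪ B) ≤ natMeas ν A + natMeas ν B := by
  rw [← natMeas_inter_add_diff (A ∪ B) A]
  exact add_le_add (natMeas_mono hν fun x _ hx => hx.2)
    (natMeas_mono hν fun x _ hx => hx.1.resolve_left hx.2)

theorem natMeas_biUnion_le (hν : ∀ x, 0 ≤ ν x) (t : Finset ℕ) (A : ℕ → Set ℕ) :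
    natMeas ν (⋃ i ∈ t, A i) ≤ ∑ i ∈ t, natMeas ν (A i) := by
  classical
  induction t using Finset.induction_on with
  | empty => simp [natMeas_empty]
  | insert i t hi ih =>
    rw [Finset.sum_insert hi, Finset.set_biUnion_insert]
    exact (natMeas_union_le hν _ _).trans (by gcongr)

theorem natMeas_singleton {x : ℕ} : natMeas ν {x} = ν x := by
  classical
  unfold natMeas
  by_cases hx : x ∈ ν.support
  · rw [Finset.sum_eq_single_of_mem x hx]
    · simp
    · intro y _ hy
      simp [hy]
  · rw [Finset.sum_eq_zero]
    · simpa using (Finsupp.notMem_support_iff.mp hx).symm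
    · intro y hy
      have : y ≠ x := fun h => hx (h ▸ hy)
      simp [this]

theorem natMeas_univ (hν : ∀ x, 0 ≤ ν x) : natMeas ν Set.univ = natNorm ν := by
  simp [natMeas, natNorm, abs_of_nonneg (hν _)]

theorem le_atPlus {x : ℕ} (hx : x ∈ ν.support) : ν x ≤ atPlus ν :=
  le_csSup ((ν.support.finite_toSet.image _).bddAbove) ⟨x, hx, rfl⟩

theorem atPlus_nonneg (hν : ∀ x, 0 ≤ ν x) : 0 ≤ atPlus ν := by
  refine Real.sSup_nonneg ?_
  rintro _ ⟨x, _, rfl⟩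
  exact hν x

theorem exists_le_of_pos_le_atPlus {ε : ℝ} (hε : 0 < ε) (h : ε ≤ atPlus ν) :
    ∃ x ∈ ν.support, ε ≤ ν x := by
  by_cases hne : ν.support.Nonempty
  · obtain ⟨x, hx, hx'⟩ := Set.Nonempty.csSup_mem (s := (fun x => ν x) '' ↑ν.support)
      (hne.to_set.image _) (ν.support.finite_toSet.image _)
    refine ⟨x, hx, ?_⟩
    have : ν x = atPlus ν := hx'
    rwa [this]
  · rw [Finset.not_nonempty_iff_eq_empty] at hne
    simp [atPlus, hne] at h
    linarith

/-- A greedy distribution of the atoms of a measure into `K` bins is almost balanced. -/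
theorem exists_balanced_coloring (hν : ∀ x, 0 ≤ ν x) {K : ℕ} (hK : 0 < K) :
    ∃ c : ℕ → ℕ, (∀ x, c x < K) ∧
      ∀ i, natMeas ν {x | c x = i} ≤ natNorm ν / K + atPlus ν := by
  classical
  have hK' : (0 : ℝ) < K := by exact_mod_cast hK
  have key : ∀ s : Finset ℕ, s ⊆ ν.support → ∃ c : ℕ → ℕ, (∀ x, c x < K) ∧
      ∀ i, ∑ x ∈ s with c x = i, ν x ≤ (∑ x ∈ s, ν x) / K + atPlus ν := by
    intro s
    induction s using Finset.induction_on with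
    | empty => exact fun _ => ⟨fun _ => 0, fun _ => hK, fun i => by simpa using atPlus_nonneg hν⟩
    | insert y s hy ih =>
      intro hs
      obtain ⟨c, hcK, hc⟩ := ih ((Finset.subset_insert _ _).trans hs)
      obtain ⟨j, hj, hjs⟩ : ∃ j ∈ Finset.range K,
          ∑ x ∈ s with c x = j, ν x ≤ (∑ x ∈ s, ν x) / K := by
        refine Finset.exists_le_of_sum_le (Finset.nonempty_range_iff.mpr hK.ne') ?_
        rw [Finset.sum_fiberwise_of_maps_to fun x _ => Finset.mem_range.mpr (hcK x)]
        simp only [Finset.sum_const, Finset.card_range, nsmul_eq_mul]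
        rw [mul_div_cancel₀ _ hK'.ne']
      refine ⟨Function.update c y j, fun x => ?_, fun i => ?_⟩
      · by_cases hx : x = y
        · simpa [hx] using hj
        · simpa [hx] using hcK x
      · have hsame : s.filter (fun x => Function.update c y j x = i) =
            s.filter fun x => c x = i := by
          refine Finset.filter_congr fun x hx => ?_
          rw [Function.update_of_ne (by rintro rfl; exact hy hx)]
        have hle : (∑ x ∈ s, ν x) / K ≤ (∑ x ∈ insert y s, ν x) / K := by
          rw [Finset.sum_insert hy]
          gcongr
          linarith [hν y]
        rw [Finset.filter_insert, hsame]
        by_cases hi : j = i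
        · subst hi
          rw [if_pos (by simp), Finset.sum_insert (by simp [hy])]
          linarith [le_atPlus (hs (Finset.mem_insert_self y s))]
        · rw [if_neg (by simpa using hi)]
          linarith [hc i]
  obtain ⟨c, hcK, hc⟩ := key ν.support subset_rfl
  refine ⟨c, hcK, fun i => ?_⟩
  convert hc i using 1
  · rw [natMeas, Finset.sum_filter]
    refine Finset.sum_congr rfl fun x _ => ?_
    simp [Set.indicator_apply]
  · simp [natNorm, abs_of_nonneg (hν _)]

theorem exists_subset_homogeneous (S : ℕ → Set ℕ) :
    ∀ (k : ℕ) (T : Set ℕ), 2 ^ k ≤ natMeas ν T →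
      ∃ B ⊆ T, 1 ≤ natMeas ν B ∧ ∀ i < k, B ⊆ S i ∨ Disjoint B (S i) := by
  intro k
  induction k with
  | zero => exact fun T hT => ⟨T, subset_rfl, by simpa using hT, by simp⟩
  | succ k ih =>
    intro T hT
    rw [← natMeas_inter_add_diff T (S k), pow_succ] at hT
    rcases le_or_gt (2 ^ k : ℝ) (natMeas ν (T ∩ S k)) with h | h
    · obtain ⟨B, hB, hB1, hBi⟩ := ih _ h
      refine ⟨B, hB.trans Set.inter_subset_left, hB1, fun i hi => ?_⟩
      rcases Nat.lt_succ_iff_lt_or_eq.mp hi with hi | rfl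
      · exact hBi i hi
      · exact Or.inl (hB.trans Set.inter_subset_right)
    · obtain ⟨B, hB, hB1, hBi⟩ := ih (T \ S k) (by linarith)
      refine ⟨B, hB.trans Set.sdiff_subset, hB1, fun i hi => ?_⟩
      rcases Nat.lt_succ_iff_lt_or_eq.mp hi with hi | rfl
      · exact hBi i hi
      · exact Or.inr (Set.disjoint_left.mpr fun x hx => (hB hx).2)

end NatMeas

/-- If each `P j` holds eventually, then so does `P (k n) n` for some slowly growing `k`. -/
theorem exists_tendsto_atTop_eventually {P : ℕ → ℕ → Prop} (hP : ∀ j, ∀ᶠ n in atTop, P j n) :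
    ∃ k : ℕ → ℕ, Tendsto k atTop atTop ∧ ∀ᶠ n in atTop, P (k n) n := by
  classical
  refine ⟨fun n => Nat.findGreatest (fun j => P j n) n, tendsto_atTop.mpr fun J => ?_, ?_⟩
  · filter_upwards [hP J, eventually_ge_atTop J] with n hn hJ
    exact Nat.le_findGreatest hJ hn
  · filter_upwards [hP 0] with n hn
    exact Nat.findGreatest_spec (P := fun j => P j n) (Nat.zero_le n) hn

section DisjointSequence

variable {μ : ℕ → (ℕ →₀ ℝ)}

theorem eventually_forall_support_lt
    (hdisj : ∀ m n, m ≠ n → Disjoint (μ m).support (μ n).support) (a : ℕ) :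
    ∀ᶠ n in atTop, ∀ x ∈ (μ n).support, a < x := by
  have h : ∀ x ∈ Finset.range (a + 1), ∀ᶠ n in atTop, x ∉ (μ n).support := by
    intro x _
    by_cases hx : ∃ m, x ∈ (μ m).support
    · obtain ⟨m, hm⟩ := hx
      filter_upwards [eventually_gt_atTop m] with n hn
      exact Finset.disjoint_left.mp (hdisj m n hn.ne) hm
    · exact Eventually.of_forall fun n hn => hx ⟨n, hn⟩
  filter_upwards [(eventually_all_finset _).mpr h] with n hn x hx
  by_contra! hxa
  exact hn x (Finset.mem_range.mpr (by omega)) hx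

theorem tendsto_natMeas_of_finite
    (hdisj : ∀ m n, m ≠ n → Disjoint (μ m).support (μ n).support) {A : Set ℕ} (hA : A.Finite) :
    Tendsto (fun n => natMeas (μ n) A) atTop (𝓝 0) := by
  obtain ⟨a, ha⟩ := hA.bddAbove
  refine tendsto_const_nhds.congr' ?_
  filter_upwards [eventually_forall_support_lt hdisj a] with n hn
  rw [natMeas_congr (B := ∅), natMeas_empty]
  exact fun x hx => iff_of_false (fun hxA => (hn x hx).not_ge (ha hxA)) (Set.notMem_empty x)

theorem tendsto_iSup_natMeas_iff (hpos : ∀ n x, 0 ≤ μ n x)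
    (hdisj : ∀ m n, m ≠ n → Disjoint (μ m).support (μ n).support) (A : Set ℕ) :
    Tendsto (fun m : ℕ => ⨆ n : ℕ, ENNReal.ofReal (natMeas (μ n) (A \ Set.Iic m))) atTop (𝓝 0) ↔
      Tendsto (fun n => natMeas (μ n) A) atTop (𝓝 0) := by
  constructor
  · intro h
    rw [ENNReal.tendsto_nhds_zero] at h
    rw [Metric.tendsto_nhds]
    intro ε hε
    obtain ⟨m, hm⟩ := (h (ENNReal.ofReal (ε / 2)) (by simpa using hε)).exists
    filter_upwards [eventually_forall_support_lt hdisj m] with n hn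
    have h1 : natMeas (μ n) (A \ Set.Iic m) ≤ ε / 2 :=
      (ENNReal.ofReal_le_ofReal_iff (by positivity)).mp ((le_iSup_iff.mpr fun b hb => hb n).trans hm)
    rw [natMeas_congr (B := A)] at h1
    · rw [Real.dist_eq, sub_zero, abs_of_nonneg (natMeas_nonneg (hpos n) A)]
      linarith
    · intro x hx
      simp [hn x hx]
  · intro h
    rw [ENNReal.tendsto_nhds_zero]
    intro ε hε
    rcases eq_or_ne ε ⊤ with rfl | hε'
    · simp
    have hε0 : 0 < ε.toReal := ENNReal.toReal_pos hε.ne' hε'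
    obtain ⟨N, hN⟩ := eventually_atTop.mp (h.eventually (gt_mem_nhds hε0))
    obtain ⟨M, hM⟩ := ((Finset.range N).biUnion fun n => (μ n).support).bddAbove
    filter_upwards [eventually_ge_atTop M] with m hm
    refine iSup_le fun n => ?_
    refine ENNReal.ofReal_le_of_le_toReal ?_
    rcases lt_or_ge n N with hn | hn
    · rw [natMeas_congr (B := ∅), natMeas_empty]
      · exact hε0.le
      · intro x hx
        have : x ≤ M := hM (by
          simp only [Finset.coe_biUnion, Set.mem_iUnion]
          exact ⟨n, by simpa using hn, hx⟩)
        simp [this.trans hm]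
    · exact (natMeas_mono (hpos n) fun x _ hx => hx.1).trans (hN n hn).le

theorem exists_uniform_coloring (hpos : ∀ n x, 0 ≤ μ n x)
    (hdisj : ∀ m n, m ≠ n → Disjoint (μ m).support (μ n).support) {K : ℕ} (hK : 0 < K) :
    ∃ c : ℕ → ℕ, (∀ x, c x < K) ∧
      ∀ n i, natMeas (μ n) {x | c x = i} ≤ natNorm (μ n) / K + atPlus (μ n) := by
  classical
  choose c hcK hc using fun n => exists_balanced_coloring (hpos n) hK
  refine ⟨fun x => if h : ∃ n, x ∈ (μ n).support then c h.choose x else 0, fun x => ?_,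
    fun n i => ?_⟩
  · dsimp only
    split_ifs
    exacts [hcK _ x, hK]
  · rw [natMeas_congr (B := {x | c n x = i})]
    · exact hc n i
    · intro x hx
      have h : ∃ n, x ∈ (μ n).support := ⟨n, hx⟩
      have hn : h.choose = n := by
        by_contra hne
        exact Finset.disjoint_left.mp (hdisj _ _ hne) h.choose_spec hx
      simp only [Set.mem_ofPred_eq, dif_pos h, hn]

theorem exists_support_bound
    (hdisj : ∀ m n, m ≠ n → Disjoint (μ m).support (μ n).support) (b : ℕ) :
    ∃ d, b ≤ d ∧ ∀ n, ∀ x ∈ (μ n).support, x < b → ∀ y ∈ (μ n).support, y < d := by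
  obtain ⟨N, hN⟩ := eventually_atTop.mp (eventually_forall_support_lt hdisj b)
  obtain ⟨M, hM⟩ := ((Finset.range N).biUnion fun n => (μ n).support).bddAbove
  refine ⟨max b (M + 1), le_max_left _ _, fun n x hx hxb y hy => ?_⟩
  have hn : n < N := by
    by_contra! hn
    exact (hN n hn x hx).not_gt hxb
  have : y ≤ M := hM (by
    simp only [Finset.coe_biUnion, Set.mem_iUnion]
    exact ⟨n, by simpa using hn, hy⟩)
  omega

/-- The gliding hump: monochromatic pieces of consecutive intervals, taken for finer and finer
colorings, can be glued together to a set in the density ideal. -/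
theorem exists_tendsto_zero_of_hump (hpos : ∀ n x, 0 ≤ μ n x)
    (hdisj : ∀ m n, m ≠ n → Disjoint (μ m).support (μ n).support)
    (hbdd : ∃ C : ℝ, ∀ n, natNorm (μ n) ≤ C)
    (hat : Tendsto (fun n => atPlus (μ n)) atTop (𝓝 0)) {R : ℕ → ℕ → Set ℕ → Prop}
    (hR : ∀ (a K : ℕ), 0 < K → ∀ c : ℕ → ℕ, (∀ x, c x < K) →
      ∃ (b : ℕ) (D : Set ℕ) (i : ℕ), D ⊆ Set.Ico a b ∧ (∀ x ∈ D, c x = i) ∧ R a b D) :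
    ∃ B : Set ℕ, Tendsto (fun n => natMeas (μ n) B) atTop (𝓝 0) ∧
      ∀ N, ∃ a ≥ N, ∃ b, R a b (B ∩ Set.Ico a b) := by
  obtain ⟨C, hC⟩ := hbdd
  choose c hcK hc using fun k : ℕ => exists_uniform_coloring hpos hdisj k.succ_pos
  choose b D col hDsub hDcol hRD using fun a k : ℕ => hR a (k + 1) k.succ_pos (c k) (hcK k)
  choose g hbg hg using exists_support_bound hdisj
  let a : ℕ → ℕ := fun k => Nat.rec 0 (fun j aj => g (max (aj + 1) (b aj j))) k
  have ha_succ : ∀ k, a (k + 1) = g (max (a k + 1) (b (a k) k)) := fun k => rfl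
  have ha_lt : ∀ k, a k + 1 ≤ a (k + 1) := fun k =>
    (le_max_left _ _).trans ((hbg _).trans (ha_succ k).ge)
  have hmono : StrictMono a := strictMono_nat_of_lt_succ ha_lt
  have hb_le : ∀ k, b (a k) k ≤ a (k + 1) := fun k =>
    (le_max_right _ _).trans ((hbg _).trans (ha_succ k).ge)
  have hsep : ∀ n k l, k < l → ∀ x ∈ (μ n).support, x < b (a k) k →
      ∀ y ∈ (μ n).support, y < a l := fun n k l hkl x hx hxb y hy =>
    (hg _ n x hx (hxb.trans_le (le_max_right _ _)) y hy).trans_le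
      ((ha_succ k).ge.trans (hmono.monotone hkl))
  refine ⟨⋃ k, D (a k) k, ?_, fun N => ⟨a N, hmono.id_le N, b (a N) N, ?_⟩⟩
  · rw [Metric.tendsto_nhds]
    intro ε hε
    have hlim : Tendsto (fun k : ℕ => C / ((k : ℝ) + 1)) atTop (𝓝 0) := by
      simpa [div_eq_mul_inv] using (tendsto_one_div_add_atTop_nhds_zero_nat (𝕜 := ℝ)).const_mul C
    obtain ⟨k₀, hk₀⟩ := eventually_atTop.mp (hlim.eventually (gt_mem_nhds (half_pos hε)))
    filter_upwards [hat.eventually (gt_mem_nhds (half_pos hε)),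
      eventually_forall_support_lt hdisj (a k₀)] with n hn1 hn2
    rw [Real.dist_eq, sub_zero, abs_of_nonneg (natMeas_nonneg (hpos n) _)]
    by_cases hmeet : ∃ k, ∃ x ∈ (μ n).support, x ∈ D (a k) k
    · obtain ⟨k, x, hx, hxD⟩ := hmeet
      have hxk := hDsub _ _ hxD
      have hk : k₀ ≤ k := by
        by_contra! hk
        exact (((hxk.2.trans_le (hb_le k)).trans_le (hmono.monotone hk)).trans (hn2 x hx)).false
      have hle : natMeas (μ n) (⋃ k, D (a k) k) ≤ natMeas (μ n) {x | c k x = col (a k) k} := by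
        refine natMeas_mono (hpos n) fun y hy hyB => ?_
        obtain ⟨l, hl⟩ := Set.mem_iUnion.mp hyB
        have hyl := hDsub _ _ hl
        rcases lt_trichotomy k l with hkl | rfl | hkl
        · exact absurd (hsep n k l hkl x hx hxk.2 y hy) hyl.1.not_gt
        · exact hDcol _ _ y hl
        · exact absurd (hsep n l k hkl y hy hyl.2 x hx) hxk.1.not_gt
      have h1 := hc k n (col (a k) k)
      have h2 : natNorm (μ n) / (k + 1 : ℕ) ≤ C / ((k : ℝ) + 1) := by
        push_cast
        gcongr
        exact hC n
      have h3 := hk₀ k hk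
      linarith
    · rw [natMeas_congr (B := ∅), natMeas_empty]
      · exact hε
      · intro x hx
        refine iff_of_false (fun h => ?_) (Set.notMem_empty x)
        obtain ⟨k, hk⟩ := Set.mem_iUnion.mp h
        exact hmeet ⟨k, x, hx, hk⟩
  · have : (⋃ k, D (a k) k) ∩ Set.Ico (a N) (b (a N) N) = D (a N) N := by
      refine Set.Subset.antisymm ?_ fun x hx => ⟨Set.mem_iUnion.mpr ⟨N, hx⟩, hDsub _ _ hx⟩
      rintro x ⟨hx, hxN⟩
      obtain ⟨l, hl⟩ := Set.mem_iUnion.mp hx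
      have hxl := hDsub _ _ hl
      rcases lt_trichotomy N l with h | rfl | h
      · exact absurd ((hxN.2.trans_le (hb_le N)).trans_le (hmono.monotone h)) hxl.1.not_gt
      · exact hl
      · exact absurd ((hxl.2.trans_le (hb_le l)).trans_le (hmono.monotone h)) hxN.1.not_gt
    rw [this]
    exact hRD _ _

/-- How the boundedness of norms together with the vanishing of atoms can fail. -/
theorem frequently_of_not_bounded_and_tendsto (hpos : ∀ n x, 0 ≤ μ n x)
    (h : ¬ ((∃ C : ℝ, ∀ n, natNorm (μ n) ≤ C) ∧ Tendsto (fun n => atPlus (μ n)) atTop (𝓝 0))) :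
    (∀ C : ℝ, ∃ᶠ n in atTop, C < natNorm (μ n)) ∨
      ∃ ε > 0, ∃ᶠ n in atTop, ∃ x ∈ (μ n).support, ε ≤ μ n x := by
  by_cases hb : ∃ C : ℝ, ∀ n, natNorm (μ n) ≤ C
  · right
    have hat : ¬ Tendsto (fun n => atPlus (μ n)) atTop (𝓝 0) := fun hat => h ⟨hb, hat⟩
    rw [Metric.tendsto_nhds] at hat
    push Not at hat
    obtain ⟨ε, hε, hf⟩ := hat
    refine ⟨ε, hε, hf.mono fun n hn => exists_le_of_pos_le_atPlus hε ?_⟩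
    rwa [Real.dist_eq, sub_zero, abs_of_nonneg (atPlus_nonneg (hpos n))] at hn
  · left
    intro C
    by_contra hC
    have hbdd : IsBoundedUnder (· ≤ ·) atTop fun n => natNorm (μ n) :=
      isBoundedUnder_of_eventually_le ((not_frequently.mp hC).mono fun n hn => not_lt.mp hn)
    obtain ⟨B, hB⟩ := hbdd.bddAbove_range
    exact hb ⟨B, fun n => hB (Set.mem_range_self n)⟩

/-- If norms are unbounded or atoms do not vanish, then no countable family splits. -/
theorem exists_unsplit (hpos : ∀ n x, 0 ≤ μ n x)
    (h : ¬ ((∃ C : ℝ, ∀ n, natNorm (μ n) ≤ C) ∧ Tendsto (fun n => atPlus (μ n)) atTop (𝓝 0)))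
    (S : ℕ → Set ℕ) :
    ∃ A : Set ℕ, ¬ Tendsto (fun n => natMeas (μ n) A) atTop (𝓝 0) ∧
      ∀ i, (A ∩ S i).Finite ∨ (A \ S i).Finite := by
  classical
  obtain ⟨ε, hε, hf⟩ : ∃ ε > 0, ∀ k, ∃ n ≥ k, ∃ B : Set ℕ, B.Finite ∧ ε ≤ natMeas (μ n) B ∧
      ∀ i < k, B ⊆ S i ∨ Disjoint B (S i) := by
    rcases frequently_of_not_bounded_and_tendsto hpos h with h | ⟨ε, hε, h⟩
    · refine ⟨1, one_pos, fun k => ?_⟩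
      obtain ⟨n, hn, hnk⟩ := frequently_atTop.mp (h (2 ^ k)) k
      obtain ⟨B, _, hB1, hBi⟩ := exists_subset_homogeneous (ν := μ n) S k (↑(μ n).support) (by
        rw [natMeas_congr (B := Set.univ), natMeas_univ (hpos n)]
        · exact hnk.le
        · simp)
      exact ⟨n, hn, B, (μ n).support.finite_toSet.subset ‹_›, hB1, hBi⟩
    · refine ⟨ε, hε, fun k => ?_⟩
      obtain ⟨n, hn, x, hx, hxε⟩ := frequently_atTop.mp h k
      refine ⟨n, hn, {x}, Set.finite_singleton x, by rwa [natMeas_singleton], fun i _ => ?_⟩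
      by_cases hxi : x ∈ S i <;> simp [hxi]
  choose n hnk B hBfin hBε hBhom using hf
  let U : Ultrafilter ℕ := hyperfilter ℕ
  have hUge : ∀ j : ℕ, ∀ᶠ k in (U : Filter ℕ), j ≤ k := fun j =>
    (Nat.hyperfilter_le_atTop (eventually_ge_atTop j))
  let P : ℕ → ℕ → Prop := fun i k =>
    if ∀ᶠ k in (U : Filter ℕ), B k ⊆ S i then B k ⊆ S i else ¬ B k ⊆ S i
  have hP : ∀ i, ∀ᶠ k in (U : Filter ℕ), P i k := by
    intro i
    by_cases hi : ∀ᶠ k in (U : Filter ℕ), B k ⊆ S i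
    · simpa only [P, if_pos hi] using hi
    · simpa only [P, if_neg hi] using Ultrafilter.eventually_not.mpr hi
  have hex : ∀ j : ℕ, ∃ k ≥ j, ∀ i ∈ Finset.range j, P i k := fun j =>
    ((hUge j).and ((eventually_all_finset _).mpr fun i _ => hP i)).exists
  choose k hkj hkP using hex
  have hfin : ∀ i, (⋃ j ∈ Finset.range (i + 1), B (k j)).Finite := fun i =>
    (Finset.range (i + 1)).finite_toSet.biUnion fun j _ => hBfin (k j)
  refine ⟨⋃ j, B (k j), fun hlim => ?_, fun i => ?_⟩
  · obtain ⟨N, hN⟩ := eventually_atTop.mp (hlim.eventually (gt_mem_nhds hε))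
    have h1 := hN (n (k N)) ((hkj N).trans (hnk (k N)))
    have h2 : natMeas (μ (n (k N))) (B (k N)) ≤ natMeas (μ (n (k N))) (⋃ j, B (k j)) :=
      natMeas_mono (hpos _) fun x _ hx => Set.mem_iUnion.mpr ⟨N, hx⟩
    linarith [hBε (k N)]
  · by_cases hi : ∀ᶠ k in (U : Filter ℕ), B k ⊆ S i
    · refine Or.inr ((hfin i).subset ?_)
      rintro x ⟨hx, hxS⟩
      obtain ⟨j, hj⟩ := Set.mem_iUnion.mp hx
      refine Set.mem_biUnion (x := j) ?_ hj
      by_contra hji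
      have := hkP j i (by simp at hji ⊢; omega)
      simp only [P, if_pos hi] at this
      exact hxS (this hj)
    · refine Or.inl ((hfin i).subset ?_)
      rintro x ⟨hx, hxS⟩
      obtain ⟨j, hj⟩ := Set.mem_iUnion.mp hx
      refine Set.mem_biUnion (x := j) ?_ hj
      by_contra hji
      have hij : i < j := by simp at hji; omega
      have := hkP j i (by simpa using hij)
      simp only [P, if_neg hi] at this
      exact Set.disjoint_left.mp ((hBhom (k j) i (hij.trans_le (hkj j))).resolve_left this) hj hxS

end DisjointSequence

/-- The uniform probability measure on the dyadic block `[2^n, 2^(n+1))`. -/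
noncomputable def dyadicMeas (n : ℕ) : ℕ →₀ ℝ :=
  Finsupp.indicator (Finset.Ico (2 ^ n) (2 ^ (n + 1))) fun _ _ => (2 ^ n : ℝ)⁻¹

theorem dyadicMeas_apply (n x : ℕ) :
    dyadicMeas n x = if x ∈ Finset.Ico (2 ^ n) (2 ^ (n + 1)) then (2 ^ n : ℝ)⁻¹ else 0 := by
  classical
  by_cases h : x ∈ Finset.Ico (2 ^ n) (2 ^ (n + 1)) <;>
    simp only [dyadicMeas, Finsupp.indicator_apply, h, dite_eq_ite]

theorem dyadicMeas_support (n : ℕ) :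
    (dyadicMeas n).support = Finset.Ico (2 ^ n) (2 ^ (n + 1)) := by
  ext x
  rw [Finsupp.mem_support_iff, dyadicMeas_apply]
  split_ifs with h
  · simpa using h
  · simpa using h

theorem dyadicMeas_nonneg (n x : ℕ) : 0 ≤ dyadicMeas n x := by
  rw [dyadicMeas_apply]
  split_ifs <;> positivity

theorem dyadicMeas_disjoint (m n : ℕ) (h : m ≠ n) :
    Disjoint (dyadicMeas m).support (dyadicMeas n).support := by
  rw [dyadicMeas_support, dyadicMeas_support, Finset.disjoint_left]
  intro x hx hx'
  rw [Finset.mem_Ico] at hx hx'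
  have h1 := (Nat.pow_lt_pow_iff_right (a := 2) (by norm_num)).mp (hx.1.trans_lt hx'.2)
  have h2 := (Nat.pow_lt_pow_iff_right (a := 2) (by norm_num)).mp (hx'.1.trans_lt hx.2)
  omega

theorem natMeas_dyadicMeas (n : ℕ) (A : Set ℕ) [DecidablePred (· ∈ A)] :
    natMeas (dyadicMeas n) A = ((Finset.Ico (2 ^ n) (2 ^ (n + 1))).filter fun x => x ∈ A).card /
      2 ^ n := by
  classical
  rw [natMeas, dyadicMeas_support, div_eq_mul_inv, ← nsmul_eq_mul, ← Finset.sum_const,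
    Finset.sum_filter]
  refine Finset.sum_congr rfl fun x hx => ?_
  rw [Set.indicator_apply]
  simp only [dyadicMeas_apply, if_pos hx]

theorem natNorm_dyadicMeas (n : ℕ) : natNorm (dyadicMeas n) = 1 := by
  classical
  rw [← natMeas_univ (dyadicMeas_nonneg n), natMeas_dyadicMeas]
  simp [pow_succ, mul_two]

theorem tendsto_atPlus_dyadicMeas : Tendsto (fun n => atPlus (dyadicMeas n)) atTop (𝓝 0) := by
  refine squeeze_zero (fun n => atPlus_nonneg (dyadicMeas_nonneg n)) (fun n => ?_)
    (tendsto_inv_atTop_zero.comp (tendsto_pow_atTop_atTop_of_one_lt (one_lt_two (α := ℝ))))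
  refine Real.sSup_le ?_ (inv_nonneg.mpr (pow_nonneg zero_le_two _))
  rintro _ ⟨x, hx, rfl⟩
  rw [Finset.mem_coe, dyadicMeas_support] at hx
  simp only [dyadicMeas_apply, if_pos hx]
  exact le_rfl

theorem mem_Zideal_iff (A : Set ℕ) :
    A ∈ Zideal ↔ Tendsto (fun n => natMeas (dyadicMeas n) A) atTop (𝓝 0) := by
  classical
  rw [← tendsto_iSup_natMeas_iff dyadicMeas_nonneg dyadicMeas_disjoint]
  have h : ∀ B : Set ℕ, phid B = ⨆ n, ENNReal.ofReal (natMeas (dyadicMeas n) B) := by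
    intro B
    refine iSup_congr fun n => ?_
    rw [natMeas_dyadicMeas, ENNReal.ofReal_div_of_pos (by positivity), ENNReal.ofReal_natCast,
      ENNReal.ofReal_pow (by norm_num), ← Set.ncard_coe_finset]
    rw [show ENNReal.ofReal 2 = 2 by simp]
    congr 3
    ext x
    simp only [Finset.coe_filter, Finset.mem_Ico, Set.mem_inter_iff, Set.mem_Ico,
      Set.mem_ofPred_eq, and_comm]
  simp only [Zideal, Set.mem_ofPred_eq, h]

/-- A probability vector can be approximated from below by the fibers of a map on `[0, N)`. -/
theorem exists_map_card_fiber_le (s : Finset ℕ) (p : ℕ → ℝ) (hp : ∀ x ∈ s, 0 ≤ p x)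
    (hsum : ∑ x ∈ s, p x = 1) (N : ℕ) :
    ∃ h : ℕ → ℕ, (∀ y < N, h y ∈ s) ∧
      ∀ x ∈ s, ((Finset.range N).filter fun y => h y = x).card ≤ N * p x + 1 := by
  classical
  induction N with
  | zero => exact ⟨id, by simp, by simp⟩
  | succ N ih =>
    obtain ⟨h, hs, hc⟩ := ih
    obtain ⟨z, hz, hzlt⟩ : ∃ z ∈ s, (((Finset.range N).filter fun y => h y = z).card : ℝ) <
        (N + 1 : ℕ) * p z := by
      refine Finset.exists_lt_of_sum_lt ?_
      rw [← Finset.mul_sum, hsum, ← Nat.cast_sum,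
        ← Finset.card_eq_sum_card_fiberwise fun y hy => hs y (by simpa using hy)]
      simp
    have hsame : ∀ x, {y ∈ Finset.range N | Function.update h N z y = x} =
        {y ∈ Finset.range N | h y = x} := fun x => by
      refine Finset.filter_congr fun y hy => ?_
      rw [Function.update_of_ne (Finset.mem_range.mp hy).ne]
    refine ⟨Function.update h N z, fun y hy => ?_, fun x hx => ?_⟩
    · by_cases hy' : y = N
      · simpa [hy'] using hz
      · simpa [hy'] using hs y (by omega)
    · rw [Finset.range_add_one, Finset.filter_insert, hsame, Function.update_self]
      by_cases hzx : z = x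
      · subst hzx
        rw [if_pos rfl, Finset.card_insert_of_notMem (by simp)]
        push_cast at hzlt ⊢
        linarith
      · rw [if_neg hzx]
        have := hc x hx
        push_cast
        linarith [hp x hx]

theorem exists_map_dyadicMeas_le {ν : ℕ →₀ ℝ} (hν : ∀ x, 0 ≤ ν x) (hpos : 0 < natNorm ν) :
    ∀ᶠ k in atTop, ∃ h : ℕ → ℕ, ∀ A : Set ℕ,
      natMeas (dyadicMeas k) (h ⁻¹' A) ≤ 2 / natNorm ν * natMeas ν A := by
  classical
  set W := natNorm ν with hW
  have hpow : Tendsto (fun k : ℕ => (2 : ℝ) ^ k) atTop atTop :=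
    tendsto_pow_atTop_atTop_of_one_lt one_lt_two
  have hbig : ∀ x ∈ ν.support, ∀ᶠ k : ℕ in atTop, W / ν x ≤ 2 ^ k :=
    fun x _ => hpow.eventually_ge_atTop _
  filter_upwards [(eventually_all_finset _).mpr hbig] with k hk
  have hsum : ∑ x ∈ ν.support, ν x / W = 1 := by
    rw [← Finset.sum_div, div_eq_one_iff_eq hpos.ne', hW]
    simp [natNorm, abs_of_nonneg (hν _)]
  obtain ⟨h, hs, hc⟩ := exists_map_card_fiber_le ν.support (fun x => ν x / W)
    (fun x _ => div_nonneg (hν x) hpos.le) hsum (2 ^ k)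
  refine ⟨fun y => h (y - 2 ^ k), fun A => ?_⟩
  have hcard : (((Finset.Ico (2 ^ k) (2 ^ (k + 1))).filter
        fun y => y ∈ (fun y => h (y - 2 ^ k)) ⁻¹' A).card : ℝ) =
      ∑ x ∈ ν.support with x ∈ A, (((Finset.range (2 ^ k)).filter fun y => h y = x).card : ℝ) := by
    rw [← Nat.cast_sum]
    congr 1
    have h1 : ((Finset.Ico (2 ^ k) (2 ^ (k + 1))).filter
          fun y => y ∈ (fun y => h (y - 2 ^ k)) ⁻¹' A).card =
        ((Finset.range (2 ^ k)).filter fun y => h y ∈ A).card := by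
      refine Finset.card_nbij' (fun y => y - 2 ^ k) (fun y => y + 2 ^ k) ?_ ?_ ?_ ?_
      · intro y hy
        simp [pow_succ] at hy ⊢
        exact ⟨by omega, hy.2⟩
      · intro y hy
        simp [pow_succ] at hy ⊢
        exact ⟨by omega, hy.2⟩
      · intro y hy
        simp [pow_succ] at hy ⊢
        omega
      · intro y hy
        simp
    rw [h1, Finset.card_eq_sum_card_fiberwise (f := h) (t := {x ∈ ν.support | x ∈ A})]
    · refine Finset.sum_congr rfl fun x hx => ?_
      congr 1
      ext y
      simp only [Finset.mem_filter] at hx ⊢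
      constructor
      · exact fun hy => ⟨hy.1.1, hy.2⟩
      · exact fun hy => ⟨⟨hy.1, hy.2 ▸ hx.2⟩, hy.2⟩
    · intro y hy
      simp at hy ⊢
      exact ⟨by simpa using hs y hy.1, hy.2⟩
  rw [natMeas_dyadicMeas, hcard, div_le_iff₀ (by positivity)]
  have hmeas : natMeas ν A = ∑ x ∈ ν.support with x ∈ A, ν x := by
    rw [natMeas, Finset.sum_filter]
    exact Finset.sum_congr rfl fun x _ => Set.indicator_apply _ _ _
  rw [hmeas, Finset.mul_sum, Finset.sum_mul]
  refine Finset.sum_le_sum fun x hx => ?_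
  have hxs := (Finset.mem_filter.mp hx).1
  have hx0 : 0 < ν x := lt_of_le_of_ne (hν x) (Finsupp.mem_support_iff.mp hxs).symm
  have h1 := hc x hxs
  push_cast at h1
  have h3 : 1 ≤ 2 ^ k * (ν x / W) := by
    rw [mul_div_assoc', le_div_iff₀ hpos]
    have := hk x hxs
    rw [div_le_iff₀ hx0] at this
    linarith
  calc _ ≤ 2 ^ k * (ν x / W) + 1 := h1
    _ ≤ 2 ^ k * (ν x / W) + 2 ^ k * (ν x / W) := by linarith
    _ = _ := by ring

section Katetov

variable {μ : ℕ → (ℕ →₀ ℝ)}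

theorem katLE_Zideal (hpos : ∀ n x, 0 ≤ μ n x)
    (huniv : ¬ Tendsto (fun n => natMeas (μ n) Set.univ) atTop (𝓝 0)) :
    KatLE {A | Tendsto (fun n => natMeas (μ n) A) atTop (𝓝 0)} Zideal := by
  rw [Metric.tendsto_nhds] at huniv
  push Not at huniv
  obtain ⟨ε, hε, hf⟩ := huniv
  choose n hn hnε using frequently_atTop.mp hf
  replace hnε : ∀ j, ε ≤ natNorm (μ (n j)) := fun j => by
    have := hnε j
    rwa [Real.dist_eq, sub_zero, abs_of_nonneg (natMeas_nonneg (hpos _) _),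
      natMeas_univ (hpos _)] at this
  obtain ⟨j, hj, hjev⟩ := exists_tendsto_atTop_eventually fun j =>
    exists_map_dyadicMeas_le (hpos (n j)) (hε.trans_le (hnε j))
  obtain ⟨h, hh⟩ := hjev.choice
  refine ⟨fun x => h (Nat.log 2 x) x, fun A hA => ?_⟩
  rw [mem_Zideal_iff]
  have hnj : Tendsto (fun k => n (j k)) atTop atTop := tendsto_atTop_mono (fun k => hn (j k)) hj
  have hlim : Tendsto (fun k => 2 / ε * natMeas (μ (n (j k))) A) atTop (𝓝 0) := by
    simpa using (Tendsto.comp (show Tendsto (fun n => natMeas (μ n) A) atTop (𝓝 0) from hA)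
      hnj).const_mul (2 / ε)
  refine squeeze_zero' (Eventually.of_forall fun k => natMeas_nonneg (dyadicMeas_nonneg k) _)
    ?_ hlim
  filter_upwards [hh] with k hk
  calc natMeas (dyadicMeas k) ((fun x => h (Nat.log 2 x) x) ⁻¹' A)
      = natMeas (dyadicMeas k) (h k ⁻¹' A) := by
        refine natMeas_congr fun x hx => ?_
        rw [dyadicMeas_support, Finset.mem_Ico] at hx
        simp only [Set.mem_preimage, Nat.log_eq_of_pow_le_of_lt_pow hx.1 hx.2]
    _ ≤ 2 / natNorm (μ (n (j k))) * natMeas (μ (n (j k))) A := hk A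
    _ ≤ 2 / ε * natMeas (μ (n (j k))) A := by
        have := natMeas_nonneg (hpos (n (j k))) A
        gcongr
        exact hnε _

theorem Zideal_katLE (hpos : ∀ n x, 0 ≤ μ n x)
    (hdisj : ∀ m n, m ≠ n → Disjoint (μ m).support (μ n).support)
    (hbdd : ∃ C : ℝ, ∀ n, natNorm (μ n) ≤ C)
    (hat : Tendsto (fun n => atPlus (μ n)) atTop (𝓝 0)) :
    KatLE Zideal {A | Tendsto (fun n => natMeas (μ n) A) atTop (𝓝 0)} := by
  classical
  obtain ⟨C, hC⟩ := hbdd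
  have hev : ∀ j : ℕ, ∀ᶠ n in atTop, 2 ^ j * atPlus (μ n) ≤ 1 := fun j => by
    have : Tendsto (fun n => 2 ^ j * atPlus (μ n)) atTop (𝓝 0) := by
      simpa using hat.const_mul (2 ^ j)
    exact this.eventually (ge_mem_nhds one_pos)
  obtain ⟨k, hk, hkev⟩ := exists_tendsto_atTop_eventually hev
  choose c hcK hc using fun n => exists_balanced_coloring (hpos n) (pow_pos two_pos (k n))
  refine ⟨fun x => if h : ∃ n, x ∈ (μ n).support then 2 ^ k h.choose + c h.choose x else 0,
    fun B hB => ?_⟩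
  rw [mem_Zideal_iff] at hB
  have hlim : Tendsto (fun n => (C + 1) * natMeas (dyadicMeas (k n)) B) atTop (𝓝 0) := by
    simpa using (hB.comp hk).const_mul (C + 1)
  refine squeeze_zero' (Eventually.of_forall fun n => natMeas_nonneg (hpos n) _) ?_ hlim
  filter_upwards [hkev] with n hn
  have hsub : natMeas (μ n) ((fun x => if h : ∃ n, x ∈ (μ n).support then
        2 ^ k h.choose + c h.choose x else 0) ⁻¹' B) ≤
      natMeas (μ n) (⋃ y ∈ {y ∈ Finset.Ico (2 ^ k n) (2 ^ (k n + 1)) | y ∈ B},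
        {x | c n x = y - 2 ^ k n}) := by
    refine natMeas_mono (hpos n) fun x hx hxB => ?_
    have h : ∃ n, x ∈ (μ n).support := ⟨n, hx⟩
    have hchoose : h.choose = n := by
      by_contra hne
      exact Finset.disjoint_left.mp (hdisj _ _ hne) h.choose_spec hx
    rw [Set.mem_preimage, dif_pos h, hchoose] at hxB
    refine Set.mem_biUnion (x := 2 ^ k n + c n x) ?_ (by simp)
    have := hcK n x
    simp only [Finset.coe_filter, Finset.mem_Ico, Set.mem_ofPred_eq, pow_succ]
    exact ⟨by omega, hxB⟩
  refine (hsub.trans (natMeas_biUnion_le (hpos n) _ _)).trans ?_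
  refine (Finset.sum_le_sum fun y _ => hc n (y - 2 ^ k n)).trans ?_
  rw [Finset.sum_const, nsmul_eq_mul, natMeas_dyadicMeas]
  have h2 : (0 : ℝ) < 2 ^ k n := by positivity
  have h3 : natNorm (μ n) / (2 ^ k n : ℕ) + atPlus (μ n) ≤ (C + 1) / 2 ^ k n := by
    push_cast
    rw [le_div_iff₀ h2, add_mul, div_mul_cancel₀ _ h2.ne']
    linarith [hC n]
  calc _ ≤ _ * ((C + 1) / 2 ^ k n) := by gcongr
    _ = _ := by ring

theorem bounded_and_tendsto_of_Zideal_katLE (hpos : ∀ n x, 0 ≤ μ n x)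
    (hdisj : ∀ m n, m ≠ n → Disjoint (μ m).support (μ n).support)
    (hZ : KatLE Zideal {A | Tendsto (fun n => natMeas (μ n) A) atTop (𝓝 0)}) :
    (∃ C : ℝ, ∀ n, natNorm (μ n) ≤ C) ∧ Tendsto (fun n => atPlus (μ n)) atTop (𝓝 0) := by
  by_contra hnot
  obtain ⟨f, hf⟩ := hZ
  choose c hcK hc using fun K : ℕ =>
    exists_uniform_coloring dyadicMeas_nonneg dyadicMeas_disjoint K.succ_pos
  obtain ⟨A, hA, hAS⟩ := exists_unsplit hpos hnot fun p =>
    {x | c p.unpair.1 (f x) = p.unpair.2}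
  have hmono : ∀ K, ∃ i, (A \ {x | c K (f x) = i}).Finite := by
    intro K
    by_contra! hinf
    refine hA (tendsto_natMeas_of_finite hdisj ?_)
    have hcover : A ⊆ ⋃ i ∈ Finset.range (K + 1), A ∩ {x | c K (f x) = i} := fun x hx =>
      Set.mem_biUnion (x := c K (f x)) (by simpa using hcK K (f x)) ⟨hx, rfl⟩
    refine ((Finset.range (K + 1)).finite_toSet.biUnion fun i _ => ?_).subset hcover
    have := hAS (Nat.pair K i)
    simp only [Nat.unpair_pair] at this
    exact this.resolve_right (hinf i)
  have hfA : f '' A ∈ Zideal := by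
    rw [mem_Zideal_iff, Metric.tendsto_nhds]
    intro ε hε
    obtain ⟨K, hK⟩ := exists_nat_one_div_lt (half_pos hε)
    obtain ⟨i, hi⟩ := hmono K
    have hE := tendsto_natMeas_of_finite dyadicMeas_disjoint (hi.image f)
    have hsum : Tendsto (fun n => atPlus (dyadicMeas n) +
        natMeas (dyadicMeas n) (f '' (A \ {x | c K (f x) = i}))) atTop (𝓝 0) := by
      simpa using tendsto_atPlus_dyadicMeas.add hE
    filter_upwards [hsum.eventually (gt_mem_nhds (half_pos hε))] with n hn
    rw [Real.dist_eq, sub_zero, abs_of_nonneg (natMeas_nonneg (dyadicMeas_nonneg n) _)]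
    have h1 : natMeas (dyadicMeas n) (f '' A) ≤ natMeas (dyadicMeas n)
        ({y | c K y = i} ∪ f '' (A \ {x | c K (f x) = i})) := by
      refine natMeas_mono (dyadicMeas_nonneg n) ?_
      rintro _ _ ⟨x, hx, rfl⟩
      by_cases hxi : c K (f x) = i
      · exact Or.inl hxi
      · exact Or.inr ⟨x, ⟨hx, hxi⟩, rfl⟩
    have h2 := natMeas_union_le (dyadicMeas_nonneg n) {y | c K y = i}
      (f '' (A \ {x | c K (f x) = i}))
    have h3 := hc K n i
    rw [natNorm_dyadicMeas] at h3
    push_cast at h3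
    linarith
  have hpre := hf _ hfA
  exact hA (squeeze_zero (fun n => natMeas_nonneg (hpos n) A)
    (fun n => natMeas_mono (hpos n) fun x _ hx => Set.mem_image_of_mem f hx) hpre)

end Katetov

section Splitting

variable {μ : ℕ → (ℕ →₀ ℝ)}

theorem exists_countable_splitting (hpos : ∀ n x, 0 ≤ μ n x)
    (hdisj : ∀ m n, m ≠ n → Disjoint (μ m).support (μ n).support)
    (hbdd : ∃ C : ℝ, ∀ n, natNorm (μ n) ≤ C)
    (hat : Tendsto (fun n => atPlus (μ n)) atTop (𝓝 0)) :
    ∃ S : Set (Set ℕ), S.Countable ∧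
      ∀ A : Set ℕ, ¬ Tendsto (fun n => natMeas (μ n) A) atTop (𝓝 0) →
        ∃ s ∈ S, ¬ Tendsto (fun n => natMeas (μ n) (A ∩ s)) atTop (𝓝 0) ∧
          ¬ Tendsto (fun n => natMeas (μ n) (A \ s)) atTop (𝓝 0) := by
  classical
  obtain ⟨C, hC⟩ := hbdd
  choose c hcK hc using fun K : ℕ => exists_uniform_coloring hpos hdisj K.succ_pos
  refine ⟨Set.range fun p : ℕ × ℕ => {x | c p.1 x < p.2}, Set.countable_range _, fun A hA => ?_⟩
  rw [Metric.tendsto_nhds] at hA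
  push Not at hA
  obtain ⟨ε, hε, hf⟩ := hA
  have hlim : Tendsto (fun K : ℕ => C / ((K : ℝ) + 1)) atTop (𝓝 0) := by
    simpa [div_eq_mul_inv] using (tendsto_one_div_add_atTop_nhds_zero_nat (𝕜 := ℝ)).const_mul C
  obtain ⟨K, hK⟩ := (hlim.eventually (gt_mem_nhds (show 0 < ε / 6 by positivity))).exists
  have hfreq : ∃ᶠ n in atTop, ∃ i ∈ Finset.range (K + 2),
      ε / 3 ≤ natMeas (μ n) (A ∩ {x | c K x < i}) ∧
        ε / 3 ≤ natMeas (μ n) (A \ {x | c K x < i}) := by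
    refine (hf.and_eventually (hat.eventually (gt_mem_nhds (show 0 < ε / 6 by positivity)))).mono ?_
    rintro n ⟨hn, hatn⟩
    rw [Real.dist_eq, sub_zero, abs_of_nonneg (natMeas_nonneg (hpos n) A)] at hn
    have hex : ∃ i, ε / 3 ≤ natMeas (μ n) (A ∩ {x | c K x < i}) := by
      refine ⟨K + 1, ?_⟩
      have : A ∩ {x | c K x < K + 1} = A := Set.inter_eq_left.mpr fun x _ => hcK K x
      rw [this]
      linarith
    have hi := Nat.find_spec hex
    have hle : Nat.find hex ≤ K + 1 := Nat.find_min' hex (by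
      have : A ∩ {x | c K x < K + 1} = A := Set.inter_eq_left.mpr fun x _ => hcK K x
      rw [this]
      linarith)
    have hne : Nat.find hex ≠ 0 := by
      intro h0
      rw [h0] at hi
      simp only [Nat.not_lt_zero, Set.ofPred_false, Set.inter_empty, natMeas_empty] at hi
      linarith
    obtain ⟨j, hj⟩ := Nat.exists_eq_succ_of_ne_zero hne
    have hjlt := Nat.find_min hex (m := j) (by omega)
    rw [not_le] at hjlt
    refine ⟨Nat.find hex, Finset.mem_range.mpr (by omega), hi, ?_⟩
    have h1 : natMeas (μ n) (A ∩ {x | c K x < Nat.find hex}) ≤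
        natMeas (μ n) (A ∩ {x | c K x < j} ∪ {x | c K x = j}) := by
      refine natMeas_mono (hpos n) fun x _ hx => ?_
      have hxlt : c K x < Nat.find hex := hx.2
      rcases lt_or_eq_of_le (show c K x ≤ j by omega) with h | h
      · exact Or.inl ⟨hx.1, h⟩
      · exact Or.inr h
    have h2 := natMeas_union_le (hpos n) (A ∩ {x | c K x < j}) {x | c K x = j}
    have h3 := hc K n j
    have h4 : natNorm (μ n) / (K + 1 : ℕ) ≤ C / ((K : ℝ) + 1) := by
      push_cast
      gcongr
      exact hC n
    have h5 := natMeas_inter_add_diff (ν := μ n) A {x | c K x < Nat.find hex}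
    linarith
  obtain ⟨i, hi⟩ : ∃ i, ∃ᶠ n in atTop, ε / 3 ≤ natMeas (μ n) (A ∩ {x | c K x < i}) ∧
        ε / 3 ≤ natMeas (μ n) (A \ {x | c K x < i}) := by
    by_contra hnot
    rw [not_exists] at hnot
    refine hfreq ?_
    have := (eventually_all_finset (Finset.range (K + 2))).mpr fun i _ =>
      not_frequently.mp (hnot i)
    exact this.mono fun n hn ⟨i, hiK, hi⟩ => hn i hiK hi
  have hthird : 0 < ε / 3 := by positivity
  refine ⟨_, ⟨(K, i), rfl⟩, fun h => hi ?_, fun h => hi ?_⟩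
  · filter_upwards [h.eventually (gt_mem_nhds hthird)] with n hn hn'
    exact hn.not_ge hn'.1
  · filter_upwards [h.eventually (gt_mem_nhds hthird)] with n hn hn'
    exact hn.not_ge hn'.2

theorem bounded_and_tendsto_of_splitting (hpos : ∀ n x, 0 ≤ μ n x)
    (hdisj : ∀ m n, m ≠ n → Disjoint (μ m).support (μ n).support)
    (huniv : ¬ Tendsto (fun n => natMeas (μ n) Set.univ) atTop (𝓝 0))
    (hS : ∃ S : Set (Set ℕ), S.Countable ∧
      ∀ A : Set ℕ, ¬ Tendsto (fun n => natMeas (μ n) A) atTop (𝓝 0) →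
        ∃ s ∈ S, ¬ Tendsto (fun n => natMeas (μ n) (A ∩ s)) atTop (𝓝 0) ∧
          ¬ Tendsto (fun n => natMeas (μ n) (A \ s)) atTop (𝓝 0)) :
    (∃ C : ℝ, ∀ n, natNorm (μ n) ≤ C) ∧ Tendsto (fun n => atPlus (μ n)) atTop (𝓝 0) := by
  by_contra hnot
  obtain ⟨S, hScount, hS⟩ := hS
  obtain ⟨s, hs, -⟩ := hS _ huniv
  obtain ⟨T, rfl⟩ := hScount.exists_eq_range ⟨s, hs⟩
  obtain ⟨A, hA, hAT⟩ := exists_unsplit hpos hnot T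
  obtain ⟨_, ⟨i, rfl⟩, h1, h2⟩ := hS A hA
  rcases hAT i with h | h
  · exact h1 (tendsto_natMeas_of_finite hdisj h)
  · exact h2 (tendsto_natMeas_of_finite hdisj h)

end Splitting

section TotallyBounded

theorem Submeasure.biUnion_le (ψ : Submeasure) (t : Finset ℕ) (A : ℕ → Set ℕ) :
    ψ.toFun (⋃ i ∈ t, A i) ≤ ∑ i ∈ t, ψ.toFun (A i) := by
  classical
  induction t using Finset.induction_on with
  | empty => simp [ψ.empty']
  | insert i t hi ih =>
    rw [Finset.sum_insert hi, Finset.set_biUnion_insert]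
    exact (ψ.subadd' _ _).trans (by gcongr)

theorem Submeasure.ne_top_of_finite (ψ : Submeasure) {A : Set ℕ} (hA : A.Finite) :
    ψ.toFun A ≠ ⊤ := by
  have h := ψ.biUnion_le hA.toFinset fun i => {i}
  have hA' : ⋃ i ∈ hA.toFinset, ({i} : Set ℕ) = A := by
    ext
    simp
  rw [hA'] at h
  exact ne_top_of_le_ne_top (ENNReal.sum_ne_top.mpr fun i _ => ψ.finite_singleton' i) h

variable {μ : ℕ → (ℕ →₀ ℝ)}

theorem ne_top_of_Exh_eq (hpos : ∀ n x, 0 ≤ μ n x)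
    (hdisj : ∀ m n, m ≠ n → Disjoint (μ m).support (μ n).support)
    (hbdd : ∃ C : ℝ, ∀ n, natNorm (μ n) ≤ C)
    (hat : Tendsto (fun n => atPlus (μ n)) atTop (𝓝 0)) (ψ : Submeasure) (hψ : ψ.LSC)
    (hExh : Exh ψ = {A | Tendsto (fun n => natMeas (μ n) A) atTop (𝓝 0)}) :
    ψ.toFun Set.univ ≠ ⊤ := by
  intro htop
  obtain ⟨B, hB, hBR⟩ := exists_tendsto_zero_of_hump hpos hdisj hbdd hat
    (R := fun _ _ D => 1 ≤ ψ.toFun D) (by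
      intro a K hK c hc
      have hIci : ψ.toFun (Set.Ici a) = ⊤ := by
        have h := ψ.subadd' (Set.Iio a) (Set.Ici a)
        rw [Set.Iio_union_Ici, htop, top_le_iff, ENNReal.add_eq_top] at h
        exact h.resolve_left (ψ.ne_top_of_finite (Set.finite_Iio a))
      have hlim := hψ (Set.Ici a)
      rw [hIci] at hlim
      obtain ⟨m, hm⟩ :=
        (hlim.eventually (lt_mem_nhds (ENNReal.natCast_lt_top K))).exists
      by_contra! hnot
      have hle : ψ.toFun (Set.Ici a ∩ Set.Iic m) ≤ K := by
        calc ψ.toFun (Set.Ici a ∩ Set.Iic m)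
            ≤ ψ.toFun (⋃ i ∈ Finset.range K, {x ∈ Set.Ico a (m + 1) | c x = i}) := by
              refine ψ.mono' fun x hx => Set.mem_biUnion (x := c x) (by simpa using hc x) ?_
              exact ⟨⟨hx.1, Nat.lt_succ_of_le hx.2⟩, rfl⟩
          _ ≤ ∑ i ∈ Finset.range K, ψ.toFun {x ∈ Set.Ico a (m + 1) | c x = i} :=
              ψ.biUnion_le _ _
          _ ≤ ∑ i ∈ Finset.range K, 1 := Finset.sum_le_sum fun i _ =>
              (hnot (m + 1) _ i (fun x hx => hx.1) fun x hx => hx.2).le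
          _ = K := by simp
      exact hm.not_ge hle)
  have hB' : B ∈ Exh ψ := hExh ▸ hB
  obtain ⟨m, hm⟩ := (Tendsto.eventually hB' (gt_mem_nhds one_pos)).exists
  obtain ⟨a, ha, b, hab⟩ := hBR (m + 1)
  refine hm.not_ge (hab.trans (ψ.mono' fun x hx => ⟨hx.1, ?_⟩))
  have := hx.2.1
  simp only [Set.mem_Iic, not_le]
  omega

theorem iSup_inter_Iic_tendsto (f : Set ℕ → ℝ≥0∞) (hmono : Monotone f)
    (hle : ∀ A, f A ≤ ⨆ m : ℕ, f (A ∩ Set.Iic m)) (A : Set ℕ) :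
    Tendsto (fun m : ℕ => f (A ∩ Set.Iic m)) atTop (𝓝 (f A)) := by
  have h : f A = ⨆ m : ℕ, f (A ∩ Set.Iic m) :=
    le_antisymm (hle A) (iSup_le fun m => hmono Set.inter_subset_left)
  rw [h]
  exact tendsto_atTop_iSup fun m n hmn =>
    hmono (Set.inter_subset_inter_right A (Set.Iic_subset_Iic.mpr hmn))

/-- The supremum of a disjointly supported sequence of measures, plus the supremum of a set
inside `X`. -/
noncomputable def densityAddSup (μ : ℕ → (ℕ →₀ ℝ)) (hpos : ∀ n x, 0 ≤ μ n x)
    (hdisj : ∀ m n, m ≠ n → Disjoint (μ m).support (μ n).support) (X : Set ℕ) : Submeasure where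
  toFun A := (⨆ n, ENNReal.ofReal (natMeas (μ n) A)) + ⨆ x ∈ A ∩ X, (x : ℝ≥0∞)
  empty' := by simp [natMeas_empty]
  finite_singleton' x := by
    refine ENNReal.add_ne_top.mpr ⟨?_, ?_⟩
    · simp only [natMeas_singleton]
      by_cases hx : ∃ m, x ∈ (μ m).support
      · obtain ⟨m, hm⟩ := hx
        refine ne_top_of_le_ne_top (ENNReal.ofReal_ne_top (r := μ m x)) (iSup_le fun n => ?_)
        by_cases hn : n = m
        · rw [hn]
        · rw [Finsupp.notMem_support_iff.mp (Finset.disjoint_right.mp (hdisj n m hn) hm)]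
          simp
      · push Not at hx
        simp [Finsupp.notMem_support_iff.mp (hx _)]
    · refine ne_top_of_le_ne_top (ENNReal.natCast_ne_top x) (iSup₂_le fun y hy => ?_)
      rw [Set.mem_singleton_iff.mp hy.1]
  mono' A B h := by
    refine add_le_add (iSup_mono fun n => ENNReal.ofReal_le_ofReal ?_)
      (biSup_mono fun x hx => ⟨h hx.1, hx.2⟩)
    exact natMeas_mono (hpos n) fun x _ hx => h hx
  subadd' A B := by
    rw [add_add_add_comm]
    refine add_le_add (iSup_le fun n => ?_) (iSup₂_le fun x hx => ?_)
    · refine (ENNReal.ofReal_le_ofReal (natMeas_union_le (hpos n) A B)).trans ?_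
      refine ENNReal.ofReal_add_le.trans (add_le_add ?_ ?_)
      · exact le_iSup (fun n => ENNReal.ofReal (natMeas (μ n) A)) n
      · exact le_iSup (fun n => ENNReal.ofReal (natMeas (μ n) B)) n
    · rcases hx.1 with h | h
      · exact (le_iSup₂ (f := fun y (_ : y ∈ A ∩ X) => (y : ℝ≥0∞)) x ⟨h, hx.2⟩).trans
          le_self_add
      · exact (le_iSup₂ (f := fun y (_ : y ∈ B ∩ X) => (y : ℝ≥0∞)) x ⟨h, hx.2⟩).trans
          le_add_self

theorem densityAddSup_LSC (hpos : ∀ n x, 0 ≤ μ n x)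
    (hdisj : ∀ m n, m ≠ n → Disjoint (μ m).support (μ n).support) (X : Set ℕ) :
    (densityAddSup μ hpos hdisj X).LSC := by
  intro A
  refine Tendsto.add (iSup_inter_Iic_tendsto (fun A => ⨆ n, ENNReal.ofReal (natMeas (μ n) A))
    ?_ (fun A => iSup_le fun n => ?_) A)
    (iSup_inter_Iic_tendsto (fun A => ⨆ x ∈ A ∩ X, (x : ℝ≥0∞)) ?_
      (fun A => iSup₂_le fun x hx => ?_) A)
  · exact fun A B h => iSup_mono fun n =>
      ENNReal.ofReal_le_ofReal (natMeas_mono (hpos n) fun x _ hx => h hx)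
  · obtain ⟨m, hm⟩ := (μ n).support.bddAbove
    have : natMeas (μ n) A = natMeas (μ n) (A ∩ Set.Iic m) :=
      natMeas_congr fun x hx => ⟨fun h => ⟨h, hm hx⟩, fun h => h.1⟩
    rw [this]
    exact (le_iSup (fun n => ENNReal.ofReal (natMeas (μ n) (A ∩ Set.Iic m))) n).trans
      (le_iSup (fun m : ℕ => ⨆ n, ENNReal.ofReal (natMeas (μ n) (A ∩ Set.Iic m))) m)
  · exact fun A B h => biSup_mono fun x hx => ⟨h hx.1, hx.2⟩
  · exact (le_iSup₂ (f := fun y (_ : y ∈ A ∩ Set.Iic x ∩ X) => (y : ℝ≥0∞)) x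
      ⟨⟨hx.1, Set.mem_Iic.mpr le_rfl⟩, hx.2⟩).trans
      (le_iSup (fun m : ℕ => ⨆ y ∈ A ∩ Set.Iic m ∩ X, (y : ℝ≥0∞)) x)

theorem Exh_densityAddSup (hpos : ∀ n x, 0 ≤ μ n x)
    (hdisj : ∀ m n, m ≠ n → Disjoint (μ m).support (μ n).support) {X : Set ℕ}
    (hX : ∀ A : Set ℕ, Tendsto (fun n => natMeas (μ n) A) atTop (𝓝 0) → (A ∩ X).Finite) :
    Exh (densityAddSup μ hpos hdisj X) =
      {A | Tendsto (fun n => natMeas (μ n) A) atTop (𝓝 0)} := by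
  ext A
  simp only [Exh, Set.mem_ofPred_eq]
  rw [← tendsto_iSup_natMeas_iff hpos hdisj]
  constructor
  · exact fun h => tendsto_of_tendsto_of_tendsto_of_le_of_le tendsto_const_nhds h
      (fun _ => zero_le) fun m => le_self_add
  · intro h
    obtain ⟨M, hM⟩ := (hX A ((tendsto_iSup_natMeas_iff hpos hdisj A).mp h)).bddAbove
    refine h.congr' ?_
    filter_upwards [eventually_ge_atTop M] with m hm
    have hempty : (A \ Set.Iic m) ∩ X = ∅ := by
      refine Set.eq_empty_of_forall_notMem fun x hx => hx.1.2 ?_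
      exact (hM ⟨hx.1.1, hx.2⟩).trans hm
    simp only [densityAddSup, hempty, Set.mem_empty_iff_false, iSup_false, iSup_bot]
    exact (add_zero _).symm

/-- The points carrying atoms bounded away from zero meet every set of the ideal finitely. -/
theorem finite_inter_of_le_atoms {ε : ℝ} (hε : 0 < ε) (hpos : ∀ n x, 0 ≤ μ n x) {A : Set ℕ}
    (hA : Tendsto (fun n => natMeas (μ n) A) atTop (𝓝 0)) :
    (A ∩ {x | ∃ n, ε ≤ μ n x}).Finite := by
  obtain ⟨N, hN⟩ := eventually_atTop.mp (hA.eventually (gt_mem_nhds hε))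
  refine ((Finset.range N).finite_toSet.biUnion
    fun n _ => (μ n).support.finite_toSet).subset ?_
  rintro x ⟨hxA, n, hn⟩
  have hxn : x ∈ (μ n).support := Finsupp.mem_support_iff.mpr (hε.trans_le hn).ne'
  refine Set.mem_biUnion (x := n) ?_ hxn
  by_contra hnN
  have h1 := hN n (by simpa using hnN)
  have h2 : natMeas (μ n) {x} ≤ natMeas (μ n) A :=
    natMeas_mono (hpos n) fun y _ hy => Set.mem_singleton_iff.mp hy ▸ hxA
  rw [natMeas_singleton] at h2
  linarith

theorem exists_Exh_eq_of_not_bounded_and_tendsto (hpos : ∀ n x, 0 ≤ μ n x)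
    (hdisj : ∀ m n, m ≠ n → Disjoint (μ m).support (μ n).support)
    (h : ¬ ((∃ C : ℝ, ∀ n, natNorm (μ n) ≤ C) ∧ Tendsto (fun n => atPlus (μ n)) atTop (𝓝 0))) :
    ∃ ψ : Submeasure, ψ.LSC ∧
      Exh ψ = {A | Tendsto (fun n => natMeas (μ n) A) atTop (𝓝 0)} ∧ ψ.toFun Set.univ = ⊤ := by
  rcases frequently_of_not_bounded_and_tendsto hpos h with h | ⟨ε, hε, h⟩
  · refine ⟨densityAddSup μ hpos hdisj ∅, densityAddSup_LSC _ _ _,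
      Exh_densityAddSup hpos hdisj (by simp), ENNReal.eq_top_of_forall_nnreal_le fun r => ?_⟩
    obtain ⟨n, hn⟩ := (h r).exists
    refine le_trans ?_ le_self_add
    refine le_trans ?_ (le_iSup (fun n => ENNReal.ofReal (natMeas (μ n) Set.univ)) n)
    rw [natMeas_univ (hpos n), ← ENNReal.ofReal_coe_nnreal]
    exact ENNReal.ofReal_le_ofReal hn.le
  · refine ⟨densityAddSup μ hpos hdisj {x | ∃ n, ε ≤ μ n x}, densityAddSup_LSC _ _ _,
      Exh_densityAddSup hpos hdisj fun A hA => finite_inter_of_le_atoms hε hpos hA,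
      ENNReal.eq_top_of_forall_nnreal_le fun r => ?_⟩
    obtain ⟨a, ha⟩ := exists_nat_ge r
    obtain ⟨n, ⟨x, hx, hxε⟩, hn⟩ :=
      (h.and_eventually (eventually_forall_support_lt hdisj a)).exists
    refine le_trans ?_ le_add_self
    refine le_trans ?_ (le_iSup₂ (f := fun y (_ : y ∈ Set.univ ∩ {x | ∃ n, ε ≤ μ n x}) =>
      (y : ℝ≥0∞)) x ⟨Set.mem_univ x, n, hxε⟩)
    have : r ≤ (x : ℝ≥0) := ha.trans (by exact_mod_cast (hn x hx).le)
    exact_mod_cast this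

end TotallyBounded

section Nikodym

theorem mem_dualFilter_iff {I : Set (Set ℕ)} (hI : IsIdeal I) (A : Set ℕ) :
    A ∈ dualFilter I ↔ Aᶜ ∈ I := by
  refine ⟨fun h => ?_, fun h => Filter.mem_generate_of_mem h⟩
  have hle : Filter.comk (· ∈ I) (hI.1 ∅ Set.finite_empty) (fun t ht s hst => hI.2.1 s t hst ht)
      (fun s hs t ht => hI.2.2.1 s t hs ht) ≤ dualFilter I :=
    Filter.le_generate_iff.mpr fun s hs => hs
  exact hle h

theorem isClopen_image_some {F : Filter ℕ} {E : Set ℕ} (hE : Eᶜ ∈ F) :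
    @IsClopen _ (NFTop F) (some '' E) := by
  let := NFTop F
  refine ⟨⟨fun _ => ?_⟩, fun h => ?_⟩
  · filter_upwards [hE] with n hn
    simpa using hn
  · simp at h

theorem sum_support_eq (ν : Option ℕ →₀ ℝ) (g : Option ℕ → ℝ) (hg : ∀ o, ν o = 0 → g o = 0)
    (T : Finset ℕ) (hT : ∀ x, some x ∈ ν.support → x ∈ T) :
    ∑ o ∈ ν.support, g o = g none + ∑ x ∈ T, g (some x) := by
  rw [← Finset.sum_insertNone]
  refine Finset.sum_subset (fun o ho => ?_) fun o _ ho => hg o (Finsupp.notMem_support_iff.mp ho)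
  cases o with
  | none => simp
  | some x => simpa using hT x ho

theorem fsMeas_eq (ν : Option ℕ →₀ ℝ) (T : Finset ℕ) (hT : ∀ x, some x ∈ ν.support → x ∈ T)
    (A : Set (Option ℕ)) :
    fsMeas ν A = A.indicator (fun o => ν o) none + ∑ x ∈ T, A.indicator (fun o => ν o) (some x) :=
  sum_support_eq ν _ (fun _ ho => Set.indicator_apply_eq_zero.mpr fun _ => ho) T hT

theorem fsNorm_eq_s3 (ν : Option ℕ →₀ ℝ) (T : Finset ℕ) (hT : ∀ x, some x ∈ ν.support → x ∈ T) :
    fsNorm ν = |ν none| + ∑ x ∈ T, |ν (some x)| :=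
  sum_support_eq ν _ (fun _ ho => by rw [ho, abs_zero]) T hT

theorem fsMeas_singleton (ν : Option ℕ →₀ ℝ) (o : Option ℕ) : fsMeas ν {o} = ν o := by
  classical
  unfold fsMeas
  simpa [Set.indicator_apply] using Eq.symm

open scoped Classical in
theorem fsMeas_image_some (ν : Option ℕ →₀ ℝ) (T : Finset ℕ)
    (hT : ∀ x, some x ∈ ν.support → x ∈ T) (E : Set ℕ) :
    fsMeas ν (some '' E) = ∑ x ∈ T with x ∈ E, ν (some x) := by
  rw [fsMeas_eq ν T hT, Finset.sum_filter]
  simp [Set.indicator_apply]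

variable {μ : ℕ → (ℕ →₀ ℝ)}

/-- A signed vector has a monochromatic part of constant sign of large sum. -/
theorem exists_monochromatic_sum (s : Finset ℕ) (v : ℕ → ℝ) {K : ℕ} (hK : 0 < K) (c : ℕ → ℕ)
    (hc : ∀ x, c x < K) {M : ℝ} (h : K * (2 * M) ≤ ∑ x ∈ s, |v x|) :
    ∃ D ⊆ s, ∃ i, (∀ x ∈ D, c x = i) ∧ M ≤ |∑ x ∈ D, v x| := by
  classical
  obtain ⟨i, -, hi⟩ : ∃ i ∈ Finset.range K, 2 * M ≤ ∑ x ∈ s with c x = i, |v x| := by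
    refine Finset.exists_le_of_sum_le (Finset.nonempty_range_iff.mpr hK.ne') ?_
    rw [Finset.sum_fiberwise_of_maps_to fun x _ => Finset.mem_range.mpr (hc x)]
    simpa using h
  rw [← Finset.sum_filter_add_sum_filter_not _ fun x => 0 ≤ v x] at hi
  have hp : ∑ x ∈ (s.filter fun x => c x = i).filter fun x => 0 ≤ v x, |v x| ≤
      |∑ x ∈ (s.filter fun x => c x = i).filter fun x => 0 ≤ v x, v x| := by
    rw [Finset.sum_congr rfl fun x hx => abs_of_nonneg (Finset.mem_filter.mp hx).2]
    exact le_abs_self _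
  have hn : ∑ x ∈ (s.filter fun x => c x = i).filter fun x => ¬ 0 ≤ v x, |v x| ≤
      |∑ x ∈ (s.filter fun x => c x = i).filter fun x => ¬ 0 ≤ v x, v x| := by
    rw [Finset.sum_congr rfl fun x hx => abs_of_neg (not_le.mp (Finset.mem_filter.mp hx).2),
      Finset.sum_neg_distrib]
    exact neg_le_abs _
  rcases le_or_gt M (∑ x ∈ (s.filter fun x => c x = i).filter fun x => 0 ≤ v x, |v x|) with h | h
  · exact ⟨_, (Finset.filter_subset _ _).trans (Finset.filter_subset _ _), i,
      fun x hx => (Finset.mem_filter.mp (Finset.mem_filter.mp hx).1).2, h.trans hp⟩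
  · exact ⟨_, (Finset.filter_subset _ _).trans (Finset.filter_subset _ _), i,
      fun x hx => (Finset.mem_filter.mp (Finset.mem_filter.mp hx).1).2, by linarith⟩

theorem hasNikodymProp_dualFilter (hpos : ∀ n x, 0 ≤ μ n x)
    (hdisj : ∀ m n, m ≠ n → Disjoint (μ m).support (μ n).support)
    (hbdd : ∃ C : ℝ, ∀ n, natNorm (μ n) ≤ C)
    (hat : Tendsto (fun n => atPlus (μ n)) atTop (𝓝 0)) :
    HasNikodymProp (dualFilter {A | Tendsto (fun n => natMeas (μ n) A) atTop (𝓝 0)}) := by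
  classical
  rintro ⟨ν, hnorm, hclopen⟩
  have hsome : ∀ E : Set ℕ, Tendsto (fun n => natMeas (μ n) E) atTop (𝓝 0) →
      Tendsto (fun n => fsMeas (ν n) (some '' E)) atTop (𝓝 0) := fun E hE =>
    hclopen _ (isClopen_image_some (Filter.mem_generate_of_mem (by simpa using hE)))
  have huniv : Tendsto (fun n => fsMeas (ν n) Set.univ) atTop (𝓝 0) :=
    hclopen _ (@isClopen_univ _ (NFTop _))
  have hpoint : ∀ x : ℕ, Tendsto (fun n => ν n (some x)) atTop (𝓝 0) := fun x => by
    simpa [fsMeas_singleton] using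
      hsome {x} (tendsto_natMeas_of_finite hdisj (Set.finite_singleton x))
  obtain ⟨B, hB, hBR⟩ := exists_tendsto_zero_of_hump hpos hdisj hbdd hat
    (R := fun a b D => ∃ n ≥ a, ∀ E : Set ℕ, E ∩ Set.Ico a b = D →
      1 ≤ |fsMeas (ν n) (some '' E)|) (by
    intro a K hK c hc
    have hinit : Tendsto (fun n => ∑ x ∈ Finset.range a, |ν n (some x)|) atTop (𝓝 0) := by
      simpa using tendsto_finsetSum (Finset.range a) fun x _ => (hpoint x).abs
    have huniv' : Tendsto (fun n => |fsMeas (ν n) Set.univ|) atTop (𝓝 0) := by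
      simpa using huniv.abs
    obtain ⟨n, hn1, hn2, hn3, hna⟩ := ((hinit.eventually (ge_mem_nhds one_pos)).and
      ((huniv'.eventually (ge_mem_nhds one_pos)).and
        ((hnorm.eventually_ge_atTop (3 + 2 * (K * (2 * 2)))).and (eventually_ge_atTop a)))).exists
    obtain ⟨M, hM⟩ := (Finset.eraseNone (ν n).support).bddAbove
    have hab : a ≤ max a (M + 1) := le_max_left _ _
    set b := max a (M + 1) with hb
    have hT : ∀ x, some x ∈ (ν n).support → x ∈ Finset.range b := fun x hx => by
      have : x ≤ M := hM (by simpa using hx)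
      rw [Finset.mem_range, hb]
      omega
    have hsplit : ∀ f : ℕ → ℝ, ∑ x ∈ Finset.range b, f x =
        ∑ x ∈ Finset.range a, f x + ∑ x ∈ Finset.Ico a b, f x := fun f =>
      (Finset.sum_range_add_sum_Ico f hab).symm
    have hlarge : K * (2 * 2) ≤ ∑ x ∈ Finset.Ico a b, |ν n (some x)| := by
      rw [fsNorm_eq_s3 _ _ hT, hsplit] at hn3
      rw [fsMeas_eq _ _ hT] at hn2
      simp only [Set.indicator_univ] at hn2
      have h1 := Finset.abs_sum_le_sum_abs (fun x => ν n (some x)) (Finset.range b)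
      rw [hsplit fun x => |ν n (some x)|] at h1
      have h2 := abs_sub_abs_le_abs_sub (ν n none) (-∑ x ∈ Finset.range b, ν n (some x))
      rw [sub_neg_eq_add, abs_neg] at h2
      linarith
    obtain ⟨D, hDs, i, hDi, hD⟩ := exists_monochromatic_sum _ _ hK c hc hlarge
    refine ⟨b, D, i, fun x hx => by simpa using hDs hx, fun x hx => hDi x hx, n, hna,
      fun E hE => ?_⟩
    have hED : {x ∈ Finset.Ico a b | x ∈ E} = D := by
      ext x
      rw [← Finset.mem_coe (s := D), ← hE]
      simp [and_comm]
    have h1 : |∑ x ∈ Finset.range a, if x ∈ E then ν n (some x) else 0| ≤ 1 := by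
      refine (Finset.abs_sum_le_sum_abs _ _).trans (le_trans (Finset.sum_le_sum fun x _ => ?_) hn1)
      split_ifs <;> simp
    rw [fsMeas_image_some _ _ hT, Finset.sum_filter, hsplit, ← Finset.sum_filter (s := .Ico a b),
      hED]
    have h2 := abs_sub_abs_le_abs_sub (∑ x ∈ D, ν n (some x))
      (-∑ x ∈ Finset.range a, if x ∈ E then ν n (some x) else 0)
    rw [sub_neg_eq_add, abs_neg, add_comm] at h2
    linarith)
  have hlim : Tendsto (fun n => |fsMeas (ν n) (some '' B)|) atTop (𝓝 0) := by
    simpa using (hsome B hB).abs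
  obtain ⟨N, hN⟩ := eventually_atTop.mp (hlim.eventually (gt_mem_nhds one_pos))
  obtain ⟨a, ha, b, n, hn, hB1⟩ := hBR N
  exact (hN n (ha.trans hn)).not_ge (hB1 B rfl)

/-- The measure `ν` on `ℕ` balanced by a point mass at infinity. -/
noncomputable def balanced (ν : ℕ →₀ ℝ) : Option ℕ →₀ ℝ :=
  Finsupp.onFinset (Finset.insertNone ν.support) (fun o => o.elim (-natNorm ν) ν) fun o ho => by
    cases o <;> simp_all

theorem balanced_none (ν : ℕ →₀ ℝ) : balanced ν none = -natNorm ν := rfl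

theorem mem_support_of_some_mem_support_balanced {ν : ℕ →₀ ℝ} (x : ℕ)
    (hx : some x ∈ (balanced ν).support) : x ∈ ν.support := by
  rw [Finsupp.mem_support_iff] at hx ⊢
  exact hx

theorem natNorm_le_fsNorm_balanced (ν : ℕ →₀ ℝ) : natNorm ν ≤ fsNorm (balanced ν) := by
  rw [fsNorm_eq_s3 _ _ mem_support_of_some_mem_support_balanced]
  exact le_add_of_nonneg_left (abs_nonneg _)

theorem fsMeas_balanced_of_notMem {ν : ℕ →₀ ℝ} {A : Set (Option ℕ)} (hA : none ∉ A) :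
    fsMeas (balanced ν) A = natMeas ν (some ⁻¹' A) := by
  rw [fsMeas_eq _ _ mem_support_of_some_mem_support_balanced, Set.indicator_of_notMem hA, zero_add]
  rfl

theorem fsMeas_balanced_of_mem {ν : ℕ →₀ ℝ} (hν : ∀ x, 0 ≤ ν x) {A : Set (Option ℕ)}
    (hA : none ∈ A) : fsMeas (balanced ν) A = -natMeas ν (some ⁻¹' A)ᶜ := by
  rw [fsMeas_eq _ _ mem_support_of_some_mem_support_balanced, Set.indicator_of_mem hA,
    balanced_none, ← natMeas_univ hν, ← natMeas_inter_add_diff Set.univ (some ⁻¹' A),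
    Set.univ_inter, ← Set.compl_eq_univ_sdiff]
  have : ∑ x ∈ ν.support, A.indicator (fun o => balanced ν o) (some x) =
      natMeas ν (some ⁻¹' A) := rfl
  linarith

theorem not_hasNikodymProp_dualFilter {I : Set (Set ℕ)} (hI : IsIdeal I) {ν : ℕ → (ℕ →₀ ℝ)}
    (hν : ∀ n x, 0 ≤ ν n x) (hnorm : Tendsto (fun n => natNorm (ν n)) atTop atTop)
    (hlim : ∀ A ∈ I, Tendsto (fun n => natMeas (ν n) A) atTop (𝓝 0)) :
    ¬ HasNikodymProp (dualFilter I) := by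
  refine not_not.mpr ⟨fun n => balanced (ν n),
    tendsto_atTop_mono (fun n => natNorm_le_fsNorm_balanced (ν n)) hnorm, fun A hA => ?_⟩
  by_cases hnone : none ∈ A
  · simp only [fsMeas_balanced_of_mem (hν _) hnone]
    rw [← neg_zero]
    exact (hlim _ ((mem_dualFilter_iff hI _).mp (hA.2 hnone))).neg
  · simp only [fsMeas_balanced_of_notMem hnone]
    have hmem : (some ⁻¹' A)ᶜ ∈ dualFilter I := hA.1.isOpen_compl hnone
    exact hlim _ (by simpa only [compl_compl] using (mem_dualFilter_iff hI _).mp hmem)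

theorem natMeas_single_of_notMem {x : ℕ} {r : ℝ} {A : Set ℕ} (hx : x ∉ A) :
    natMeas (Finsupp.single x r) A = 0 := by
  rw [natMeas_congr (B := ∅), natMeas_empty]
  intro y hy
  have : y = x := by simpa using Finsupp.support_single_subset hy
  simpa [this] using hx

theorem bounded_and_tendsto_of_hasNikodymProp (hpos : ∀ n x, 0 ≤ μ n x)
    (hdisj : ∀ m n, m ≠ n → Disjoint (μ m).support (μ n).support)
    (hI : IsIdeal {A | Tendsto (fun n => natMeas (μ n) A) atTop (𝓝 0)})
    (hN : HasNikodymProp (dualFilter {A | Tendsto (fun n => natMeas (μ n) A) atTop (𝓝 0)})) :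
    (∃ C : ℝ, ∀ n, natNorm (μ n) ≤ C) ∧ Tendsto (fun n => atPlus (μ n)) atTop (𝓝 0) := by
  by_contra hnot
  rcases frequently_of_not_bounded_and_tendsto hpos hnot with h | ⟨ε, hε, h⟩
  · choose n hn hnorm using fun j : ℕ => frequently_atTop.mp (h j) j
    refine not_hasNikodymProp_dualFilter hI (ν := fun j => μ (n j)) (fun j => hpos _)
      (tendsto_atTop_mono (fun j => (hnorm j).le) tendsto_natCast_atTop_atTop)
      (fun A hA => ?_) hN
    have hA' : Tendsto (fun k => natMeas (μ k) A) atTop (𝓝 0) := hA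
    have hn' : Tendsto n atTop atTop := tendsto_atTop_mono hn tendsto_id
    exact hA'.comp hn'
  · choose n hn using fun j : ℕ =>
      (h.and_eventually (eventually_forall_support_lt hdisj j)).exists
    choose x hx hxε using fun j => (hn j).1
    refine not_hasNikodymProp_dualFilter hI (ν := fun j => Finsupp.single (x j) (j : ℝ))
      (fun j y => ?_) ?_ (fun A hA => ?_) hN
    · by_cases hy : x j = y <;> simp [hy]
    · refine tendsto_atTop_mono (fun j => ?_) (tendsto_natCast_atTop_atTop (R := ℝ))
      by_cases hj : (j : ℝ) = 0
      · simp [hj, natNorm]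
      · simp [natNorm, Finsupp.support_single, hj]
    · obtain ⟨M, hM⟩ := (finite_inter_of_le_atoms hε hpos hA).bddAbove
      refine tendsto_const_nhds.congr' ?_
      filter_upwards [eventually_ge_atTop M] with j hj
      refine (natMeas_single_of_notMem fun hxA => ?_).symm
      have h1 : x j ≤ M := hM ⟨hxA, n j, hxε j⟩
      have h2 := (hn j).2 _ (hx j)
      omega

end Nikodym

/-- Theorem `nikodym_equiv`. For a density ideal `I` generated by a disjointly
supported sequence `(μ_n)` of finitely supported nonnegative measures on `ℕ`, the following are
equivalent: (1) `sup_n ‖μ_n‖ < ∞` and `at⁺(μ_n) → 0`; (2) `P(ω)/I` contains a countable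
splitting family; (3) `I` is totally bounded; (4) `I ≡_K Z`; (5) `I*` has the Nikodym property. -/
theorem density_ideal_nikodym_tfae (μ : ℕ → (ℕ →₀ ℝ))
    (hpos : ∀ n x, 0 ≤ μ n x)
    (hdisj : ∀ m n, m ≠ n → Disjoint (μ m).support (μ n).support)
    (I : Set (Set ℕ))
    (hI : I = {A : Set ℕ |
      Tendsto (fun m : ℕ => ⨆ n : ℕ, ENNReal.ofReal (natMeas (μ n) (A \ Set.Iic m)))
        atTop (nhds 0)})
    (hIdeal : IsIdeal I) :
    List.TFAE
      [ (∃ C : ℝ, ∀ n, natNorm (μ n) ≤ C) ∧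
          Tendsto (fun n => atPlus (μ n)) atTop (nhds 0),
        ∃ S : Set (Set ℕ), S.Countable ∧
          ∀ A : Set ℕ, A ∉ I → ∃ s ∈ S, A ∩ s ∉ I ∧ A \ s ∉ I,
        ∀ ψ : Submeasure, ψ.LSC → Exh ψ = I → ψ.toFun Set.univ ≠ ⊤,
        KatLE I Zideal ∧ KatLE Zideal I,
        HasNikodymProp (dualFilter I) ] := by
  have hI' : I = {A : Set ℕ | Tendsto (fun n => natMeas (μ n) A) atTop (nhds 0)} := by
    rw [hI]
    ext A
    exact tendsto_iSup_natMeas_iff hpos hdisj A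
  clear hI
  subst hI'
  have huniv := hIdeal.2.2.2
  tfae_have 1 → 2 := fun h => exists_countable_splitting hpos hdisj h.1 h.2
  tfae_have 2 → 1 := bounded_and_tendsto_of_splitting hpos hdisj huniv
  tfae_have 1 → 3 := fun h => ne_top_of_Exh_eq hpos hdisj h.1 h.2
  tfae_have 3 → 1 := fun h => by
    by_contra hnot
    obtain ⟨ψ, hψ, hExh, htop⟩ := exists_Exh_eq_of_not_bounded_and_tendsto hpos hdisj hnot
    exact h ψ hψ hExh htop
  tfae_have 1 → 4 := fun h => ⟨katLE_Zideal hpos huniv, Zideal_katLE hpos hdisj h.1 h.2⟩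
  tfae_have 4 → 1 := fun h => bounded_and_tendsto_of_Zideal_katLE hpos hdisj h.2
  tfae_have 1 → 5 := fun h => hasNikodymProp_dualFilter hpos hdisj h.1 h.2
  tfae_have 5 → 1 := bounded_and_tendsto_of_hasNikodymProp hpos hdisj hIdeal
  tfae_finish
end
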